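/- Let n ≥ 5 and 1 < p < (n+4)/(n-4), and let u be a nonnegative C⁴ solution of Δ²u = u^p in the punctured ball B₁\{0} ⊂ ℝⁿ. Then there exists a constant C₁, depending only on n and p, such that for all x with 0 < |x| ≤ 1/4, one has Σ_{k=0}^{3} |x|^{4/(p-1)+k} |∇^k u(x)| ≤ C₁, where |∇^k u(x)| denotes the norm of the k-th (iterated) derivative of u at x. -/

import Mathlib

open MeasureTheory Metric Filter

/-- The Euclidean Laplacian `Δu` of `u : ℝⁿ → ℝ`, computed as the trace of the second
derivative: `Δu(x) = ∑ i, ∂²u/∂xᵢ²(x)`. -/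
noncomputable def lap {n : ℕ} (u : EuclideanSpace ℝ (Fin n) → ℝ) :
    EuclideanSpace ℝ (Fin n) → ℝ :=
  fun x => ∑ i : Fin n,
    iteratedFDeriv ℝ 2 u x ![EuclideanSpace.single i 1, EuclideanSpace.single i 1]

/-- The biharmonic operator `Δ²u = Δ(Δu)`. -/
noncomputable def bilap {n : ℕ} (u : EuclideanSpace ℝ (Fin n) → ℝ) :
    EuclideanSpace ℝ (Fin n) → ℝ :=
  lap (lap u)

section GradientEstimates

open scoped ContDiff Topology

/-- The derivative of `f` in the direction `e`. -/
noncomputable def pd {n : ℕ} (e : EuclideanSpace ℝ (Fin n)) (f : EuclideanSpace ℝ (Fin n) → ℝ) :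
    EuclideanSpace ℝ (Fin n) → ℝ :=
  fun x => fderiv ℝ f x e

/-- The `i`-th standard basis vector. -/
noncomputable abbrev bvec {n : ℕ} (i : Fin n) : EuclideanSpace ℝ (Fin n) :=
  EuclideanSpace.single i (1 : ℝ)

section Calculus

lemma natCast_le_infty (k : ℕ) : (k : WithTop ℕ∞) ≤ ∞ := by
  exact_mod_cast (le_top : (k : ℕ∞) ≤ ⊤)

variable {n : ℕ}

local notation "E" => EuclideanSpace ℝ (Fin n)

lemma contDiff_pd {m k : WithTop ℕ∞} {f : E → ℝ} (hf : ContDiff ℝ k f) (hmk : m + 1 ≤ k) (e : E) :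
    ContDiff ℝ m (pd e f) :=
  (hf.fderiv_right hmk).clm_apply contDiff_const

lemma continuous_pd {k : WithTop ℕ∞} {f : E → ℝ} (hf : ContDiff ℝ k f) (hk : 1 ≤ k) (e : E) :
    Continuous (pd e f) :=
  (contDiff_pd (m := 0) hf (by simpa using hk) e).continuous

lemma hasCompactSupport_pd {f : E → ℝ} (hf : HasCompactSupport f) (e : E) :
    HasCompactSupport (pd e f) :=
  hf.fderiv_apply ℝ e

lemma tsupport_pd_subset (f : E → ℝ) (e : E) : tsupport (pd e f) ⊆ tsupport f :=
  tsupport_fderiv_apply_subset ℝ e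

lemma lap_apply_eq {f : E → ℝ} {x : E} (hf : ContDiffAt ℝ 2 f x) :
    lap f x = ∑ i : Fin n, pd (bvec i) (pd (bvec i) f) x := by
  unfold lap pd
  refine Finset.sum_congr rfl fun i _ => ?_
  rw [iteratedFDeriv_two_apply]
  have h : DifferentiableAt ℝ (fderiv ℝ f) x :=
    (hf.fderiv_right (m := 1) (by norm_num)).differentiableAt (by norm_num)
  rw [fderiv_clm_apply h (differentiableAt_const _)]
  simp

lemma lap_eq {f : E → ℝ} (hf : ContDiff ℝ 2 f) :
    lap f = fun x => ∑ i : Fin n, pd (bvec i) (pd (bvec i) f) x :=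
  funext fun _ => lap_apply_eq hf.contDiffAt

lemma contDiff_lap {m k : WithTop ℕ∞} {f : E → ℝ} (hf : ContDiff ℝ k f) (hmk : m + 2 ≤ k) :
    ContDiff ℝ m (lap f) := by
  have h2 : (m + 1) + 1 ≤ k := by rwa [add_assoc, one_add_one_eq_two]
  rw [lap_eq (hf.of_le (le_trans le_add_self hmk))]
  exact ContDiff.sum fun i _ => contDiff_pd (contDiff_pd hf h2 _) le_rfl _

lemma contDiff_lap_infty {f : E → ℝ} (hf : ContDiff ℝ ∞ f) : ContDiff ℝ ∞ (lap f) :=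
  contDiff_infty.2 fun k => contDiff_lap hf (by exact_mod_cast natCast_le_infty (k + 2))

lemma tsupport_lap_subset {f : E → ℝ} (hf : ContDiff ℝ 2 f) : tsupport (lap f) ⊆ tsupport f := by
  refine closure_minimal (fun x hx => ?_) (isClosed_tsupport f)
  by_contra hx'
  apply hx
  rw [lap_eq hf]
  refine Finset.sum_eq_zero fun i _ => ?_
  exact image_eq_zero_of_notMem_tsupport fun h =>
    hx' (tsupport_pd_subset _ _ (tsupport_pd_subset _ _ h))

lemma hasCompactSupport_lap {f : E → ℝ} (hf : ContDiff ℝ 2 f) (hs : HasCompactSupport f) :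
    HasCompactSupport (lap f) :=
  hs.mono' (subset_closure.trans (tsupport_lap_subset hf))

lemma contDiff_bilap {m k : WithTop ℕ∞} {f : E → ℝ} (hf : ContDiff ℝ k f) (hmk : m + 4 ≤ k) :
    ContDiff ℝ m (bilap f) := by
  refine contDiff_lap (k := m + 2) (contDiff_lap hf ?_) le_rfl
  rw [add_assoc]; convert hmk using 2; norm_num

/-- `lap` is a local operator. -/
lemma lap_congr {f g : E → ℝ} {x : E} (h : f =ᶠ[𝓝 x] g) : lap f =ᶠ[𝓝 x] lap g := by
  filter_upwards [h.eventuallyEq_nhds] with y hy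
  unfold lap
  rw [(hy.iteratedFDeriv ℝ 2).eq_of_nhds]

lemma bilap_congr {f g : E → ℝ} {x : E} (h : f =ᶠ[𝓝 x] g) : bilap f x = bilap g x :=
  (lap_congr (lap_congr h)).eq_of_nhds

lemma pd_comp {f : E → ℝ} (x : E) (t : ℝ) (e : E) :
    pd e (fun y => f (x + t • y)) = fun y => t * pd e f (x + t • y) := by
  funext y
  have := fderiv_comp_smul (𝕜 := ℝ) (f := fun z => f (x + z)) (x := y) t
  unfold pd
  rw [this, fderiv_comp_add_left]
  simp

lemma pd_const_mul {f : E → ℝ} (c : ℝ) (e : E) :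
    pd e (fun y => c * f y) = fun y => c * pd e f y := by
  funext y
  unfold pd
  have : (fun y => c * f y) = c • f := rfl
  rw [this, fderiv_const_smul_field]
  simp

lemma lap_comp {f : E → ℝ} (hf : ContDiff ℝ 2 f) (x : E) (c t : ℝ) :
    lap (fun y => c * f (x + t • y)) = fun y => c * t ^ 2 * lap f (x + t • y) := by
  have h : ContDiff ℝ 2 (fun y : E => c * f (x + t • y)) := by fun_prop
  rw [lap_eq h, lap_eq hf]
  simp only [pd_const_mul, pd_comp, Finset.mul_sum]
  funext y
  refine Finset.sum_congr rfl fun i _ => ?_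
  ring

lemma bilap_comp {f : E → ℝ} (hf : ContDiff ℝ 4 f) (x : E) (c t : ℝ) :
    bilap (fun y => c * f (x + t • y)) = fun y => c * t ^ 4 * bilap f (x + t • y) := by
  unfold bilap
  rw [lap_comp (hf.of_le (by norm_num)), lap_comp (contDiff_lap hf (by norm_num))]
  funext y
  ring

lemma integral_pd_mul {f g : E → ℝ} (hf : ContDiff ℝ 1 f) (hg : ContDiff ℝ 1 g)
    (hgs : HasCompactSupport g) (e : E) :
    ∫ x, pd e f x * g x = - ∫ x, f x * pd e g x := by
  have h1 : Integrable (fun x => pd e f x * g x) :=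
    ((continuous_pd hf le_rfl e).mul hg.continuous).integrable_of_hasCompactSupport
      (hgs.mul_left)
  have h2 : Integrable (fun x => f x * pd e g x) :=
    (hf.continuous.mul (continuous_pd hg le_rfl e)).integrable_of_hasCompactSupport
      ((hasCompactSupport_pd hgs e).mul_left)
  have h3 : Integrable (fun x => f x * g x) :=
    (hf.continuous.mul hg.continuous).integrable_of_hasCompactSupport (hgs.mul_left)
  have := integral_mul_fderiv_eq_neg_fderiv_mul_of_integrable (𝕜 := ℝ) (v := e) h1 h2 h3
    (fun x _ => hf.differentiable one_ne_zero x) (fun x _ => hg.differentiable one_ne_zero x)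
  unfold pd at *
  linarith

lemma integral_lap_mul {f g : E → ℝ} (hf : ContDiff ℝ 2 f) (hg : ContDiff ℝ 2 g)
    (hgs : HasCompactSupport g) :
    ∫ x, lap f x * g x = ∫ x, f x * lap g x := by
  have hpf : ∀ i : Fin n, ContDiff ℝ 1 (pd (bvec i) f) := fun i => contDiff_pd hf (by norm_num) _
  have hpg : ∀ i : Fin n, ContDiff ℝ 1 (pd (bvec i) g) := fun i => contDiff_pd hg (by norm_num) _
  rw [lap_eq hf, lap_eq hg]
  simp only [Finset.sum_mul, Finset.mul_sum]
  rw [integral_finsetSum, integral_finsetSum]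
  · refine Finset.sum_congr rfl fun i _ => ?_
    rw [integral_pd_mul (hpf i) (hg.of_le (by norm_num)) hgs,
      integral_pd_mul (hf.of_le (by norm_num)) (hpg i) (hasCompactSupport_pd hgs _), neg_neg]
  · intro i _
    exact (hf.continuous.mul (continuous_pd (hpg i) le_rfl _)).integrable_of_hasCompactSupport
      ((hasCompactSupport_pd (hasCompactSupport_pd hgs _) _).mul_left)
  · intro i _
    exact ((continuous_pd (hpf i) le_rfl _).mul hg.continuous).integrable_of_hasCompactSupport
      hgs.mul_left

lemma integral_bilap_mul {f g : E → ℝ} (hf : ContDiff ℝ 4 f) (hg : ContDiff ℝ 4 g)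
    (hgs : HasCompactSupport g) :
    ∫ x, bilap f x * g x = ∫ x, f x * bilap g x := by
  have h2f : ContDiff ℝ 2 (lap f) := contDiff_lap hf (by norm_num)
  have h2g : ContDiff ℝ 2 (lap g) := contDiff_lap hg (by norm_num)
  have hg2 : ContDiff ℝ 2 g := hg.of_le (by norm_num)
  unfold bilap
  rw [integral_lap_mul h2f hg2 hgs,
    integral_lap_mul (hf.of_le (by norm_num)) h2g (hasCompactSupport_lap hg2 hgs)]

lemma pd_comm {f : E → ℝ} (hf : ContDiff ℝ 2 f) (d e : E) : pd d (pd e f) = pd e (pd d f) := by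
  funext x
  have h : DifferentiableAt ℝ (fderiv ℝ f) x :=
    (hf.contDiffAt.fderiv_right (m := 1) (by norm_num)).differentiableAt (by norm_num)
  unfold pd
  rw [fderiv_clm_apply h (differentiableAt_const _), fderiv_clm_apply h (differentiableAt_const _)]
  have := (hf.contDiffAt (x := x)).isSymmSndFDerivAt (by simp)
  simpa using this d e

lemma pd_sum {ι : Type*} {s : Finset ι} {f : ι → E → ℝ} (hf : ∀ i ∈ s, ContDiff ℝ 1 (f i)) (e : E) :
    pd e (fun x => ∑ i ∈ s, f i x) = fun x => ∑ i ∈ s, pd e (f i) x := by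
  funext x
  unfold pd
  rw [fderiv_fun_sum fun i hi => (hf i hi).differentiable one_ne_zero x]
  simp

lemma pd_lap {f : E → ℝ} (hf : ContDiff ℝ ∞ f) (e : E) : pd e (lap f) = lap (pd e f) := by
  have h : ∀ d : E, ContDiff ℝ ∞ (pd d f) := fun d => contDiff_pd hf (by simp) d
  have h' : ∀ d d' : E, ContDiff ℝ ∞ (pd d (pd d' f)) := fun d d' => contDiff_pd (h d') (by simp) d
  rw [lap_eq (hf.of_le (natCast_le_infty _)), lap_eq ((h e).of_le (natCast_le_infty _)),
    pd_sum fun i _ => (h' _ _).of_le (natCast_le_infty _)]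
  funext x
  refine Finset.sum_congr rfl fun i _ => ?_
  rw [pd_comm ((h _).of_le (natCast_le_infty _)),
    pd_comm (hf.of_le (natCast_le_infty _)) e]

lemma pd_bilap {f : E → ℝ} (hf : ContDiff ℝ ∞ f) (e : E) : pd e (bilap f) = bilap (pd e f) := by
  unfold bilap
  rw [pd_lap (contDiff_lap_infty hf), pd_lap hf]

/-- Iterated directional derivative. -/
noncomputable def ipd : (L : List E) → (E → ℝ) → E → ℝ
  | [], f => f
  | e :: L, f => pd e (ipd L f)

lemma contDiff_ipd {m k : WithTop ℕ∞} {f : E → ℝ} (hf : ContDiff ℝ k f) (L : List E)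
    (h : m + L.length ≤ k) : ContDiff ℝ m (ipd L f) := by
  induction L generalizing m with
  | nil => exact hf.of_le (by simpa using h)
  | cons e L ih =>
    refine contDiff_pd (ih (m := m + 1) ?_) le_rfl e
    rw [List.length_cons] at h
    rw [add_assoc, add_comm (1 : WithTop ℕ∞)]
    exact_mod_cast h

lemma contDiff_ipd_infty {f : E → ℝ} (hf : ContDiff ℝ ∞ f) (L : List E) :
    ContDiff ℝ ∞ (ipd L f) := by
  induction L with
  | nil => exact hf
  | cons e L ih => exact contDiff_pd ih (by simp) e

lemma tsupport_ipd_subset (f : E → ℝ) (L : List E) : tsupport (ipd L f) ⊆ tsupport f := by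
  induction L with
  | nil => exact subset_rfl
  | cons e L ih => exact (tsupport_pd_subset _ _).trans ih

lemma hasCompactSupport_ipd {f : E → ℝ} (hs : HasCompactSupport f) (L : List E) :
    HasCompactSupport (ipd L f) :=
  hs.mono' (subset_closure.trans (tsupport_ipd_subset f L))

lemma ipd_pd {f : E → ℝ} (hf : ContDiff ℝ ∞ f) (L : List E) (e : E) :
    ipd L (pd e f) = pd e (ipd L f) := by
  induction L with
  | nil => rfl
  | cons d L ih =>
    simp only [ipd]
    rw [ih, pd_comm ((contDiff_ipd_infty hf L).of_le (natCast_le_infty _))]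

lemma ipd_bilap {f : E → ℝ} (hf : ContDiff ℝ ∞ f) (L : List E) :
    ipd L (bilap f) = bilap (ipd L f) := by
  induction L with
  | nil => rfl
  | cons d L ih => simp only [ipd]; rw [ih, pd_bilap (contDiff_ipd_infty hf L)]

lemma ipd_comp {f : E → ℝ} (L : List E) (t : ℝ) :
    ipd L (fun y => f (t • y)) = fun y => t ^ L.length * ipd L f (t • y) := by
  induction L with
  | nil => simp [ipd]
  | cons e L ih =>
    have h := pd_comp (f := ipd L f) 0 t e
    simp only [zero_add] at h
    simp only [ipd]
    rw [ih, pd_const_mul, h]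
    funext y
    rw [List.length_cons]; ring

lemma integral_ipd_mul {f g : E → ℝ} (L : List E) (hf : ContDiff ℝ L.length f)
    (hg : ContDiff ℝ ∞ g) (hgs : HasCompactSupport g) :
    ∫ x, ipd L f x * g x = (-1) ^ L.length * ∫ x, f x * ipd L g x := by
  induction L generalizing g with
  | nil => simp [ipd]
  | cons e L ih =>
    have h1 : ContDiff ℝ 1 (ipd L f) := contDiff_ipd hf L (by
      rw [List.length_cons, add_comm]; exact_mod_cast le_rfl)
    have h2 : ContDiff ℝ ∞ (pd e g) := contDiff_pd hg (by simp) e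
    simp only [ipd]
    rw [integral_pd_mul h1 (hg.of_le (natCast_le_infty _)) hgs,
      ih (hf.of_le (by simp)) h2 (hasCompactSupport_pd hgs e), ipd_pd hg, List.length_cons]
    ring

lemma iteratedFDeriv_apply_eq_ipd {f : E → ℝ} (j : ℕ) (hf : ContDiff ℝ j f) (m : Fin j → E)
    (x : E) : iteratedFDeriv ℝ j f x m = ipd (List.ofFn m) f x := by
  induction j generalizing x with
  | zero => simp [ipd]
  | succ j ih =>
    have h : DifferentiableAt ℝ (iteratedFDeriv ℝ j f) x :=
      hf.differentiable_iteratedFDeriv (by exact_mod_cast Nat.lt_succ_self j) x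
    rw [h.iteratedFDeriv_succ_apply_left', List.ofFn_succ]
    simp only [ipd, pd]
    congr 2
    funext y
    exact ih (hf.of_le (by exact_mod_cast Nat.le_succ j)) (Fin.tail m) y

end Calculus

section Kernel

variable {n : ℕ}

local notation "E" => EuclideanSpace ℝ (Fin n)

lemma pd_radial {g : ℝ → ℝ} (hg : Differentiable ℝ g) (e y : E) :
    pd e (fun y => g (‖y‖ ^ 2)) y = 2 * inner ℝ y e * deriv g (‖y‖ ^ 2) := by
  have h1 : HasFDerivAt (fun y : E => ‖y‖ ^ 2) (2 • innerSL ℝ y) y :=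
    (hasStrictFDerivAt_norm_sq y).hasFDerivAt
  have h2 := (hg (‖y‖ ^ 2)).hasDerivAt.comp_hasFDerivAt y h1
  unfold pd
  have h3 : (fun y : E => g (‖y‖ ^ 2)) = g ∘ fun y => ‖y‖ ^ 2 := rfl
  rw [h3, h2.fderiv]
  simp
  ring

lemma lap_radial {g : ℝ → ℝ} (hg : ContDiff ℝ ∞ g) :
    lap (fun y : E => g (‖y‖ ^ 2)) =
      fun y => 2 * n * deriv g (‖y‖ ^ 2) + 4 * ‖y‖ ^ 2 * deriv (deriv g) (‖y‖ ^ 2) := by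
  have hg1 : ContDiff ℝ ∞ (deriv g) := ((contDiff_infty_iff_deriv (𝕜 := ℝ)).1 hg).2
  have hd : Differentiable ℝ g := hg.differentiable (by simp)
  have hd1 : Differentiable ℝ (deriv g) := hg1.differentiable (by simp)
  have hG : ContDiff ℝ ∞ (fun y : E => g (‖y‖ ^ 2)) := hg.comp (contDiff_norm_sq ℝ)
  rw [lap_eq (hG.of_le (natCast_le_infty 2))]
  have h1 : ∀ e : E, pd e (fun y => g (‖y‖ ^ 2)) =
      fun y => (2 * inner ℝ y e) * deriv g (‖y‖ ^ 2) := fun e => funext fun y => pd_radial hd e y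
  have h2 : ∀ e y : E, pd e (pd e fun y => g (‖y‖ ^ 2)) y =
      2 * ‖e‖ ^ 2 * deriv g (‖y‖ ^ 2) +
        4 * (inner ℝ y e) ^ 2 * deriv (deriv g) (‖y‖ ^ 2) := by
    intro e y
    rw [h1]
    have hA : DifferentiableAt ℝ (fun y : E => 2 * inner ℝ y e) y :=
      (differentiableAt_fun_id.inner ℝ (differentiableAt_const e)).const_mul 2
    have hB : DifferentiableAt ℝ (fun y : E => deriv g (‖y‖ ^ 2)) y :=
      ((hg1.comp (contDiff_norm_sq ℝ)).differentiable (by simp)) y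
    have h3 := pd_radial hd1 e y
    unfold pd at h3 ⊢
    rw [fderiv_fun_mul hA hB]
    simp only [add_apply, smul_apply, smul_eq_mul, h3]
    have h4 : fderiv ℝ (fun y : E => 2 * inner ℝ y e) y e = 2 * ‖e‖ ^ 2 := by
      rw [fderiv_const_mul (differentiableAt_fun_id.inner ℝ (differentiableAt_const e)), smul_apply,
        fderiv_inner_apply ℝ differentiableAt_fun_id (differentiableAt_const e)]
      simp
    rw [h4]; ring
  funext y
  simp only [h2, Finset.sum_add_distrib]
  simp only [bvec, PiLp.norm_single, EuclideanSpace.inner_single_right]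
  rw [← Finset.sum_mul, ← Finset.mul_sum]
  simp
  rw [← Finset.sum_mul, ← Finset.mul_sum, EuclideanSpace.real_norm_sq_eq]

/-- A smooth profile, positive on `(-∞, 1)` and vanishing on `[1, ∞)`. -/
noncomputable def prof (s : ℝ) : ℝ := Real.smoothTransition (1 - s)

lemma contDiff_prof : ContDiff ℝ ∞ prof :=
  Real.smoothTransition.contDiff.comp (contDiff_const.sub contDiff_id)

lemma prof_nonneg (s : ℝ) : 0 ≤ prof s := Real.smoothTransition.nonneg _

lemma prof_pos {s : ℝ} (hs : s < 1) : 0 < prof s :=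
  Real.smoothTransition.pos_of_pos (by linarith)

lemma prof_eq_zero {s : ℝ} (hs : 1 ≤ s) : prof s = 0 :=
  Real.smoothTransition.zero_of_nonpos (by linarith)

lemma deriv_eq_zero_of_eq_zero_Ici {g : ℝ → ℝ} (hg : Differentiable ℝ g)
    (h0 : ∀ s, 1 ≤ s → g s = 0) {s : ℝ} (hs : 1 ≤ s) : deriv g s = 0 := by
  have h1 : HasDerivWithinAt g (deriv g s) (Set.Ici s) s := (hg s).hasDerivAt.hasDerivWithinAt
  have h2 : HasDerivWithinAt g 0 (Set.Ici s) s :=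
    (hasDerivWithinAt_const s (Set.Ici s) (0 : ℝ)).congr (fun x hx => h0 x (hs.trans hx)) (h0 s hs)
  exact (uniqueDiffOn_Ici s s Set.self_mem_Ici).eq_deriv _ h1 h2

/-- The profile of the Laplacian of `y ↦ prof (‖y‖ ^ 2)`. -/
noncomputable def lapProf (n : ℕ) (s : ℝ) : ℝ :=
  2 * n * deriv prof s + 4 * s * deriv (deriv prof) s

lemma contDiff_deriv_prof : ContDiff ℝ ∞ (deriv prof) :=
  ((contDiff_infty_iff_deriv (𝕜 := ℝ)).1 contDiff_prof).2

lemma contDiff_deriv_deriv_prof : ContDiff ℝ ∞ (deriv (deriv prof)) :=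
  ((contDiff_infty_iff_deriv (𝕜 := ℝ)).1 contDiff_deriv_prof).2

lemma deriv_prof_eq_zero {s : ℝ} (hs : 1 ≤ s) : deriv prof s = 0 :=
  deriv_eq_zero_of_eq_zero_Ici (contDiff_prof.differentiable (by simp)) (fun _ => prof_eq_zero) hs

lemma deriv_deriv_prof_eq_zero {s : ℝ} (hs : 1 ≤ s) : deriv (deriv prof) s = 0 :=
  deriv_eq_zero_of_eq_zero_Ici (contDiff_deriv_prof.differentiable (by simp))
    (fun _ => deriv_prof_eq_zero) hs

lemma contDiff_lapProf (n : ℕ) : ContDiff ℝ ∞ (lapProf n) :=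
  (contDiff_const.mul contDiff_deriv_prof).add
    ((contDiff_const.mul contDiff_id).mul contDiff_deriv_deriv_prof)

lemma lapProf_eq_zero (n : ℕ) {s : ℝ} (hs : 1 ≤ s) : lapProf n s = 0 := by
  simp [lapProf, deriv_prof_eq_zero hs, deriv_deriv_prof_eq_zero hs]

/-- A nonnegative radial bump function supported in the closed unit ball. -/
noncomputable def kap (y : E) : ℝ := prof (‖y‖ ^ 2)

/-- The function with `∇ Δ kap = y ↦ rho y • y`. -/
noncomputable def rho (y : E) : ℝ := 2 * deriv (lapProf n) (‖y‖ ^ 2)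

lemma contDiff_kap : ContDiff ℝ ∞ (kap : E → ℝ) := contDiff_prof.comp (contDiff_norm_sq ℝ)

lemma contDiff_rho : ContDiff ℝ ∞ (rho : E → ℝ) :=
  contDiff_const.mul
    (((contDiff_infty_iff_deriv (𝕜 := ℝ)).1 (contDiff_lapProf n)).2.comp (contDiff_norm_sq ℝ))

lemma kap_nonneg (y : E) : 0 ≤ kap y := prof_nonneg _

lemma pd_lap_kap (e y : E) : pd e (lap (kap : E → ℝ)) y = inner ℝ y e * rho y := by
  have h : lap (kap : E → ℝ) = fun y => lapProf n (‖y‖ ^ 2) := lap_radial contDiff_prof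
  rw [h, pd_radial ((contDiff_lapProf n).differentiable (by simp))]
  unfold rho
  ring

lemma kap_eq_zero {y : E} (hy : 1 ≤ ‖y‖) : kap y = 0 := prof_eq_zero (by nlinarith)

lemma rho_eq_zero {y : E} (hy : 1 ≤ ‖y‖) : rho y = 0 := by
  unfold rho
  rw [deriv_eq_zero_of_eq_zero_Ici ((contDiff_lapProf n).differentiable (by simp))
    (fun _ => lapProf_eq_zero n) (by nlinarith), mul_zero]

lemma tsupport_subset_closedBall {f : E → ℝ} (hf : ∀ y, 1 ≤ ‖y‖ → f y = 0) :
    tsupport f ⊆ closedBall 0 1 := by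
  refine closure_minimal (fun y hy => ?_) isClosed_closedBall
  by_contra h
  rw [mem_closedBall_zero_iff, not_le] at h
  exact hy (hf y h.le)

lemma tsupport_kap : tsupport (kap : E → ℝ) ⊆ closedBall 0 1 :=
  tsupport_subset_closedBall fun _ => kap_eq_zero

lemma tsupport_rho : tsupport (rho : E → ℝ) ⊆ closedBall 0 1 :=
  tsupport_subset_closedBall fun _ => rho_eq_zero

lemma hasCompactSupport_kap : HasCompactSupport (kap : E → ℝ) :=
  (isCompact_closedBall 0 1).of_isClosed_subset (isClosed_tsupport _) tsupport_kap

lemma hasCompactSupport_rho : HasCompactSupport (rho : E → ℝ) :=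
  (isCompact_closedBall 0 1).of_isClosed_subset (isClosed_tsupport _) tsupport_rho

lemma integral_prof_pos (b : ℕ) :
    0 < ∫ r in Set.Ioi (0 : ℝ), r ^ (b + 4) * (2 * deriv (lapProf (b + 5)) (r ^ 2)) := by
  set h := lapProf (b + 5) with hh
  have ch : ContDiff ℝ ∞ h := contDiff_lapProf _
  have ch1 : ContDiff ℝ ∞ (deriv h) := ((contDiff_infty_iff_deriv (𝕜 := ℝ)).1 ch).2
  have hh0 : ∀ s, 1 ≤ s → deriv h s = 0 := fun s hs =>
    deriv_eq_zero_of_eq_zero_Ici (ch.differentiable (by simp)) (fun _ => lapProf_eq_zero _) hs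
  have e1 : ∫ r in Set.Ioi (0 : ℝ), r ^ (b + 4) * (2 * deriv h (r ^ 2)) =
      ∫ r in (0 : ℝ)..1, r ^ (b + 4) * (2 * deriv h (r ^ 2)) := by
    rw [intervalIntegral.integral_of_le zero_le_one]
    refine (setIntegral_eq_of_subset_of_forall_sdiff_eq_zero measurableSet_Ioi
      Set.Ioc_subset_Ioi_self fun r hr => ?_)
    have : 1 < r := by
      by_contra hc
      exact hr.2 ⟨hr.1, not_lt.1 hc⟩
    rw [hh0 _ (by nlinarith)]; simp
  have hsq : ∀ r : ℝ, HasDerivAt (fun r : ℝ => r ^ 2) (2 * r) r := fun r => by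
    simpa using hasDerivAt_pow 2 r
  have dcomp : ∀ g : ℝ → ℝ, ContDiff ℝ ∞ g → ∀ r : ℝ,
      HasDerivAt (fun r => g (r ^ 2)) (deriv g (r ^ 2) * (2 * r)) r := fun g hg r =>
    HasDerivAt.comp (h₂ := g) r ((hg.differentiable (by simp)) (r ^ 2)).hasDerivAt (hsq r)
  have dh := dcomp h ch
  have dk := dcomp prof contDiff_prof
  have dk1 := dcomp (deriv prof) contDiff_deriv_prof
  have hpow : ∀ (m : ℕ) (r : ℝ), HasDerivAt (fun r : ℝ => r ^ (m + 1)) (((m : ℝ) + 1) * r ^ m) r :=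
    fun m r => by simpa using hasDerivAt_pow (m + 1) r
  let Q : ℝ → ℝ := fun r => r ^ (b + 3) * h (r ^ 2) -
    (b + 3) * (2 * (r ^ (b + 3) * deriv prof (r ^ 2)) + 2 * (r ^ (b + 1) * prof (r ^ 2)))
  have dQ : ∀ r, HasDerivAt Q (r ^ (b + 4) * (2 * deriv h (r ^ 2)) -
      2 * (b + 3) * (b + 1) * (r ^ b * prof (r ^ 2))) r := by
    intro r
    have := ((hpow (b + 2) r).mul (dh r)).sub
      (((((hpow (b + 2) r).mul (dk1 r)).const_mul 2).add
        (((hpow b r).mul (dk r)).const_mul 2)).const_mul ((b : ℝ) + 3))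
    refine this.congr_deriv ?_
    have hval : h (r ^ 2) = 2 * ((b + 5 : ℕ) : ℝ) * deriv prof (r ^ 2) +
      4 * r ^ 2 * deriv (deriv prof) (r ^ 2) := rfl
    rw [hval]
    push_cast
    ring
  have c1 : Continuous fun r : ℝ => r ^ (b + 4) * (2 * deriv h (r ^ 2)) := by
    have := ch1.continuous
    fun_prop
  have c2 : Continuous fun r : ℝ => r ^ b * prof (r ^ 2) := by
    have := contDiff_prof.continuous
    fun_prop
  have c3 : Continuous fun r : ℝ => 2 * ((b : ℝ) + 3) * (b + 1) * (r ^ b * prof (r ^ 2)) :=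
    continuous_const.mul c2
  have ftc : ∫ r in (0 : ℝ)..1, (r ^ (b + 4) * (2 * deriv h (r ^ 2)) -
      2 * (b + 3) * (b + 1) * (r ^ b * prof (r ^ 2))) = Q 1 - Q 0 :=
    intervalIntegral.integral_eq_sub_of_hasDerivAt (fun r _ => dQ r)
      ((c1.sub c3).intervalIntegrable _ _)
  have q1 : Q 1 = 0 := by
    simp [Q, hh, lapProf_eq_zero _ le_rfl, deriv_prof_eq_zero le_rfl, prof_eq_zero le_rfl]
  have q0 : Q 0 = 0 := by simp [Q]
  rw [intervalIntegral.integral_sub (c1.intervalIntegrable _ _)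
    (c3.intervalIntegrable _ _), intervalIntegral.integral_const_mul,
    q1, q0] at ftc
  rw [e1]
  have pos : 0 < ∫ r in (0 : ℝ)..1, r ^ b * prof (r ^ 2) := by
    refine intervalIntegral.intervalIntegral_pos_of_pos_on (c2.intervalIntegrable _ _)
      (fun r hr => ?_) zero_lt_one
    exact mul_pos (pow_pos hr.1 _) (prof_pos (by nlinarith [hr.1, hr.2]))
  have : 0 < 2 * ((b : ℝ) + 3) * (b + 1) * ∫ r in (0 : ℝ)..1, r ^ b * prof (r ^ 2) := by positivity
  linarith

lemma integral_rho_pos (hn : 5 ≤ n) : 0 < ∫ y : E, rho y := by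
  obtain ⟨b, rfl⟩ := Nat.exists_eq_add_of_le' hn
  have := integral_fun_norm_addHaar (volume : Measure (EuclideanSpace ℝ (Fin (b + 5))))
    (fun r : ℝ => 2 * deriv (lapProf (b + 5)) (r ^ 2))
  have e : ∫ y : EuclideanSpace ℝ (Fin (b + 5)), rho y = _ := this
  rw [e, finrank_euclideanSpace_fin]
  have h1 : 0 < (volume : Measure (EuclideanSpace ℝ (Fin (b + 5)))).real (ball 0 1) :=
    ENNReal.toReal_pos (measure_ball_pos _ _ one_pos).ne' measure_ball_lt_top.ne
  have h2 := integral_prof_pos b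
  rw [nsmul_eq_mul, smul_eq_mul]
  simp only [smul_eq_mul, show b + 5 - 1 = b + 4 from rfl]
  positivity

end Kernel

section Formula

variable {n : ℕ}

local notation "E" => EuclideanSpace ℝ (Fin n)

lemma fderiv_apply_eq_sum (f : E → ℝ) (x y : E) :
    fderiv ℝ f x y = ∑ i, inner ℝ y (bvec i) * pd (bvec i) f x := by
  conv_lhs => rw [← (EuclideanSpace.basisFun (Fin n) ℝ).sum_repr y]
  simp [pd, EuclideanSpace.inner_single_right]

lemma integral_eq_setIntegral_closedBall {f : E → ℝ} (hf : ∀ y, 1 ≤ ‖y‖ → f y = 0) :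
    ∫ y, f y = ∫ y in closedBall (0 : E) 1, f y := by
  refine (setIntegral_eq_integral_of_forall_compl_eq_zero fun y hy => hf y ?_).symm
  rw [mem_closedBall_zero_iff, not_le] at hy
  exact hy.le

lemma continuous_integral_comp_smul_mul {g φ : E → ℝ} (hg : Continuous g) (hφ : Continuous φ)
    (h0 : ∀ y, 1 ≤ ‖y‖ → φ y = 0) (x : E) :
    Continuous fun t : ℝ => ∫ y, g (x + t • y) * φ y := by
  have : ∀ t : ℝ, ∫ y, g (x + t • y) * φ y = ∫ y in closedBall (0 : E) 1, g (x + t • y) * φ y :=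
    fun t => integral_eq_setIntegral_closedBall fun y hy => by rw [h0 y hy, mul_zero]
  simp only [this]
  exact continuous_parametric_integral_of_continuous (by fun_prop) (isCompact_closedBall 0 1)

lemma hasDerivAt_integral_comp_smul {f : E → ℝ} (hf : ContDiff ℝ 1 f) (t : ℝ) :
    HasDerivAt (fun t : ℝ => ∫ y, f (t • y) * rho y)
      (∫ y, fderiv ℝ f (t • y) y * rho y) t := by
  have hr : Continuous (rho : E → ℝ) := contDiff_rho.continuous
  have hfd : Continuous (fderiv ℝ f) := hf.continuous_fderiv one_ne_zero
  have hc : Continuous fun q : ℝ × E => fderiv ℝ f (q.1 • q.2) q.2 * rho q.2 := by fun_prop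
  obtain ⟨C, hC⟩ := ((isCompact_closedBall t 1).prod
    (isCompact_closedBall (0 : E) 1)).exists_bound_of_continuousOn hc.continuousOn
  refine (hasDerivAt_integral_of_dominated_loc_of_deriv_le (s := ball t 1)
    (bound := (closedBall (0 : E) 1).indicator fun _ => C) (ball_mem_nhds t one_pos)
    (F := fun t y => f (t • y) * rho y) (F' := fun t y => fderiv ℝ f (t • y) y * rho y)
    ?_ ?_ ?_ ?_ ?_ ?_).2
  · have := hf.continuous
    exact Eventually.of_forall fun s => Continuous.aestronglyMeasurable (by fun_prop)
  · have := hf.continuous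
    exact Continuous.integrable_of_hasCompactSupport (by fun_prop) hasCompactSupport_rho.mul_left
  · exact Continuous.aestronglyMeasurable (by fun_prop)
  · refine Eventually.of_forall fun y s hs => ?_
    by_cases hy : y ∈ closedBall (0 : E) 1
    · rw [Set.indicator_of_mem hy]
      exact hC (s, y) ⟨ball_subset_closedBall hs, hy⟩
    · rw [Set.indicator_of_notMem hy]
      rw [mem_closedBall_zero_iff, not_le] at hy
      rw [rho_eq_zero hy.le]; simp
  · exact (integrable_indicator_iff measurableSet_closedBall).2
      (integrableOn_const measure_closedBall_lt_top.ne)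
  · refine Eventually.of_forall fun y s _ => ?_
    have h1 : HasDerivAt (fun s : ℝ => s • y) y s := by
      simpa using (hasDerivAt_id s).smul_const y
    exact (((hf.differentiable one_ne_zero) (s • y)).hasFDerivAt.comp_hasDerivAt s h1).mul_const _

lemma contDiff_lap_kap : ContDiff ℝ ∞ (lap (kap : E → ℝ)) := contDiff_lap_infty contDiff_kap

lemma contDiff_bilap_kap : ContDiff ℝ ∞ (bilap (kap : E → ℝ)) :=
  contDiff_lap_infty contDiff_lap_kap

lemma hasCompactSupport_lap_kap : HasCompactSupport (lap (kap : E → ℝ)) :=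
  hasCompactSupport_lap (contDiff_kap.of_le (natCast_le_infty 2)) hasCompactSupport_kap

lemma hasCompactSupport_bilap_kap : HasCompactSupport (bilap (kap : E → ℝ)) :=
  hasCompactSupport_lap (contDiff_lap_kap.of_le (natCast_le_infty 2)) hasCompactSupport_lap_kap

lemma pd_comp_smul (f : E → ℝ) (t : ℝ) (e : E) :
    pd e (fun y => f (t • y)) = fun y => t * pd e f (t • y) := by
  simpa using pd_comp (f := f) 0 t e

lemma integral_fderiv_mul_rho {f : E → ℝ} (hf : ContDiff ℝ 1 f) (t : ℝ) :
    t * ∫ y, fderiv ℝ f (t • y) y * rho y = - ∫ y, f (t • y) * bilap kap y := by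
  have hft : ContDiff ℝ 1 (fun y : E => f (t • y)) := by fun_prop
  have hK := contDiff_lap_kap (n := n)
  have hK1 : ∀ i : Fin n, ContDiff ℝ ∞ (pd (bvec i) (lap (kap : E → ℝ))) :=
    fun i => contDiff_pd hK (by simp) _
  have hs1 : ∀ i : Fin n, HasCompactSupport (pd (bvec i) (lap (kap : E → ℝ))) :=
    fun i => hasCompactSupport_pd hasCompactSupport_lap_kap _
  have e1 : ∀ y, t * (fderiv ℝ f (t • y) y * rho y) =
      ∑ i, pd (bvec i) (fun y => f (t • y)) y * pd (bvec i) (lap kap) y := by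
    intro y
    rw [fderiv_apply_eq_sum, Finset.sum_mul, Finset.mul_sum]
    refine Finset.sum_congr rfl fun i _ => ?_
    rw [pd_comp_smul, pd_lap_kap]
    ring
  rw [← integral_const_mul]
  simp only [e1]
  rw [integral_finsetSum]
  · have : bilap (kap : E → ℝ) = fun y => ∑ i, pd (bvec i) (pd (bvec i) (lap kap)) y :=
      lap_eq (hK.of_le (natCast_le_infty 2))
    rw [this]
    simp only [Finset.mul_sum]
    rw [integral_finsetSum, ← Finset.sum_neg_distrib]
    · refine Finset.sum_congr rfl fun i _ => ?_
      exact integral_pd_mul hft ((hK1 i).of_le (natCast_le_infty 1)) (hs1 i) _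
    · intro i _
      exact (hft.continuous.mul
        (continuous_pd (hK1 i) (natCast_le_infty 1) _)).integrable_of_hasCompactSupport
        ((hasCompactSupport_pd (hs1 i) _).mul_left)
  · intro i _
    exact ((continuous_pd hft le_rfl _).mul (hK1 i).continuous).integrable_of_hasCompactSupport
      (hs1 i).mul_left

lemma integral_ipd_mul_bilap_kap {W : E → ℝ} (hW : ContDiff ℝ 4 W) (L : List E)
    (hL : L.length ≤ 3) (t : ℝ) :
    t ^ L.length * ∫ y, ipd L W (t • y) * bilap kap y =
      (-1) ^ L.length * t ^ 4 * ∫ y, bilap W (t • y) * ipd L kap y := by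
  have hWt : ContDiff ℝ 4 (fun y : E => W (t • y)) := by fun_prop
  have h1 := integral_ipd_mul L (f := fun y => W (t • y)) (g := bilap kap)
    (hWt.of_le (by exact_mod_cast hL.trans (by norm_num))) contDiff_bilap_kap
    hasCompactSupport_bilap_kap
  rw [ipd_comp, ipd_bilap contDiff_kap, ← integral_bilap_mul hWt
    ((contDiff_ipd_infty contDiff_kap L).of_le (natCast_le_infty 4))
    (hasCompactSupport_ipd hasCompactSupport_kap L)] at h1
  have h2 := bilap_comp hW 0 1 t
  simp only [zero_add, one_mul] at h2
  rw [h2] at h1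
  simp only [mul_assoc] at h1
  rw [integral_const_mul, integral_const_mul] at h1
  rw [h1, mul_assoc]

lemma hasDerivAt_integral_ipd {W : E → ℝ} (hW : ContDiff ℝ 4 W) (L : List E)
    (hL : L.length ≤ 3) {t : ℝ} (ht : t ≠ 0) :
    HasDerivAt (fun t : ℝ => ∫ y, ipd L W (t • y) * rho y)
      (-(-1) ^ L.length * t ^ (3 - L.length) * ∫ y, bilap W (t • y) * ipd L kap y) t := by
  have h1 : ContDiff ℝ 1 (ipd L W) := contDiff_ipd hW L (by
    have : 1 + L.length ≤ 4 := by omega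
    exact_mod_cast this)
  refine (hasDerivAt_integral_comp_smul h1 t).congr_deriv ?_
  have e1 := integral_fderiv_mul_rho h1 t
  have e2 := integral_ipd_mul_bilap_kap hW L hL t
  obtain ⟨m, hm⟩ := Nat.exists_eq_add_of_le hL
  have e3 : 3 - L.length = m := by omega
  have e4 : t ^ 4 = t * t ^ L.length * t ^ m := by
    rw [← pow_succ', ← pow_add]; congr 1; omega
  rw [e3]
  apply mul_left_cancel₀ ht
  apply mul_left_cancel₀ (pow_ne_zero L.length ht)
  rw [e1]
  rw [e4] at e2
  linear_combination -e2

lemma continuous_integral_ipd {W : E → ℝ} (hW : ContDiff ℝ 4 W) (L : List E)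
    (hL : L.length ≤ 3) : Continuous (fun t : ℝ => ∫ y, ipd L W (t • y) * rho y) := by
  have h1 : ContDiff ℝ 0 (ipd L W) := contDiff_ipd hW L (by
    have : 0 + L.length ≤ 4 := by omega
    exact_mod_cast this)
  simpa using continuous_integral_comp_smul_mul h1.continuous
    (contDiff_rho (n := n)).continuous (fun y => rho_eq_zero) 0

/-- Representation of a `C⁴` function through its bilaplacian. -/
lemma representation {W : E → ℝ} (hW : ContDiff ℝ 4 W) {R : ℝ} (hR : 0 ≤ R) :
    (∫ y : E, rho y) * W 0 = (∫ y, W (R • y) * rho y) +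
      ∫ t in (0 : ℝ)..R, t ^ 3 * ∫ y, bilap W (t • y) * kap y := by
  have hd : ∀ t ∈ Set.Ioo 0 R, HasDerivAt (fun t : ℝ => ∫ y, W (t • y) * rho y)
      (-(t ^ 3 * ∫ y, bilap W (t • y) * kap y)) t := fun t ht => by
    simpa [ipd] using hasDerivAt_integral_ipd hW [] (by simp) ht.1.ne'
  have hcont : Continuous fun t : ℝ => -(t ^ 3 * ∫ y, bilap W (t • y) * kap y) := by
    have := continuous_integral_comp_smul_mul (contDiff_bilap (m := 0) hW (by norm_num)).continuous
      (contDiff_kap (n := n)).continuous (fun y => kap_eq_zero) 0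
    simp only [zero_add] at this
    fun_prop
  have := intervalIntegral.integral_eq_sub_of_hasDerivAt_of_le hR
    (continuous_integral_ipd hW [] (by simp)).continuousOn hd (hcont.intervalIntegrable _ _)
  rw [intervalIntegral.integral_neg] at this
  simp only [ipd, zero_smul, integral_const_mul] at this
  linarith

lemma abs_integral_mul_le {g φ : E → ℝ} {B : ℝ} {t : ℝ} (ht0 : 0 ≤ t) (ht1 : t ≤ 1)
    (hφ : Continuous φ) (hφs : tsupport φ ⊆ closedBall 0 1)
    (hB : ∀ y ∈ closedBall (0 : E) 1, |g y| ≤ B) :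
    |∫ y, g (t • y) * φ y| ≤ B * ∫ y, |φ y| := by
  have hcs : HasCompactSupport φ :=
    (isCompact_closedBall 0 1).of_isClosed_subset (isClosed_tsupport _) hφs
  rw [← integral_const_mul, ← Real.norm_eq_abs]
  refine norm_integral_le_of_norm_le
    (((hφ.integrable_of_hasCompactSupport hcs).abs).const_mul B) (Eventually.of_forall fun y => ?_)
  rw [Real.norm_eq_abs, abs_mul]
  by_cases hy : y ∈ tsupport φ
  · refine mul_le_mul_of_nonneg_right (hB _ ?_) (abs_nonneg _)
    have := mem_closedBall_zero_iff.1 (hφs hy)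
    rw [mem_closedBall_zero_iff, norm_smul, Real.norm_of_nonneg ht0]
    nlinarith [norm_nonneg y]
  · rw [image_eq_zero_of_notMem_tsupport hy]; simp

lemma abs_ipd_le {W : E → ℝ} (hW : ContDiff ℝ 4 W) (L : List E) (hL : L.length ≤ 3) {B : ℝ}
    (hB : ∀ y ∈ closedBall (0 : E) 1, |W y| ≤ B)
    (hB' : ∀ y ∈ closedBall (0 : E) 1, |bilap W y| ≤ B) :
    (∫ y : E, rho y) * |ipd L W 0| ≤ B * ((∫ y : E, |ipd L rho y|) + ∫ y : E, |ipd L kap y|) := by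
  have hB0 : 0 ≤ B := (abs_nonneg _).trans (hB 0 (by simp))
  have cr := (contDiff_ipd_infty (contDiff_rho (n := n)) L).continuous
  have ck := (contDiff_ipd_infty (contDiff_kap (n := n)) L).continuous
  have sr := (tsupport_ipd_subset (rho : E → ℝ) L).trans tsupport_rho
  have sk := (tsupport_ipd_subset (kap : E → ℝ) L).trans tsupport_kap
  obtain ⟨c, hc, hc'⟩ := exists_hasDerivAt_eq_slope
    (fun t : ℝ => ∫ y, ipd L W (t • y) * rho y) _ zero_lt_one
    (continuous_integral_ipd hW L hL).continuousOn
    (fun t ht => hasDerivAt_integral_ipd hW L hL ht.1.ne')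
  simp only [one_smul, zero_smul, integral_const_mul] at hc'
  have e1 := integral_ipd_mul L (f := W) (g := rho)
    (hW.of_le (by exact_mod_cast hL.trans (by norm_num))) contDiff_rho hasCompactSupport_rho
  rw [e1] at hc'
  have b1 := abs_integral_mul_le zero_le_one le_rfl cr sr hB
  simp only [one_smul] at b1
  have b2 := abs_integral_mul_le hc.1.le hc.2.le ck sk hB'
  have key : (∫ y : E, rho y) * ipd L W 0 = (-1) ^ L.length * (∫ y, W y * ipd L rho y) +
      (-1) ^ L.length * c ^ (3 - L.length) * ∫ y, bilap W (c • y) * ipd L kap y := by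
    rw [sub_zero, div_one] at hc'
    linear_combination hc'
  have hc3 : |c ^ (3 - L.length)| ≤ 1 := by
    rw [abs_of_nonneg (pow_nonneg hc.1.le _)]
    exact pow_le_one₀ hc.1.le hc.2.le
  calc (∫ y : E, rho y) * |ipd L W 0| ≤ |(∫ y : E, rho y) * ipd L W 0| := by
        rw [abs_mul]
        exact mul_le_mul_of_nonneg_right (le_abs_self _) (abs_nonneg _)
    _ ≤ |∫ y, W y * ipd L rho y| + |∫ y, bilap W (c • y) * ipd L kap y| := by
        rw [key]
        refine (abs_add_le _ _).trans ?_
        simp only [abs_mul, abs_pow, abs_neg, abs_one, one_pow, one_mul]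
        rw [← abs_pow]
        gcongr
        exact mul_le_of_le_one_left (abs_nonneg _) hc3
    _ ≤ _ := by rw [mul_add]; exact add_le_add b1 b2

lemma exists_integral_abs_ipd_le {φ : E → ℝ} (hφ : ContDiff ℝ ∞ φ)
    (hφs : tsupport φ ⊆ closedBall 0 1) (j : ℕ) :
    ∃ C : ℝ, 0 ≤ C ∧ ∀ m : Fin j → E, ∫ y, |ipd (List.ofFn m) φ y| ≤ C * ∏ i, ‖m i‖ := by
  have hc : Continuous (iteratedFDeriv ℝ j φ) :=
    hφ.continuous_iteratedFDeriv (natCast_le_infty j)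
  obtain ⟨C, hC⟩ := (isCompact_closedBall (0 : E) 1).exists_bound_of_continuousOn hc.continuousOn
  have hC0 : 0 ≤ C := (norm_nonneg _).trans (hC 0 (by simp))
  refine ⟨C * (volume : Measure E).real (closedBall 0 1), by positivity, fun m => ?_⟩
  have hz : ∀ y ∉ closedBall (0 : E) 1, |ipd (List.ofFn m) φ y| = 0 := fun y hy => by
    rw [image_eq_zero_of_notMem_tsupport fun h => hy (hφs (tsupport_ipd_subset _ _ h)), abs_zero]
  rw [← setIntegral_eq_integral_of_forall_compl_eq_zero hz]
  have := norm_setIntegral_le_of_norm_le_const (μ := (volume : Measure E))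
    (s := closedBall (0 : E) 1) (f := fun y => |ipd (List.ofFn m) φ y|) (C := C * ∏ i, ‖m i‖)
    measure_closedBall_lt_top (fun y hy => by
      rw [Real.norm_eq_abs, abs_abs,
        ← iteratedFDeriv_apply_eq_ipd j (hφ.of_le (natCast_le_infty j)) m y]
      refine ((iteratedFDeriv ℝ j φ y).le_opNorm m).trans ?_
      exact mul_le_mul_of_nonneg_right (hC y hy) (by positivity))
  calc _ ≤ _ := (le_abs_self _).trans this
    _ = _ := by ring

/-- Interior derivative estimates for the biharmonic operator. -/
lemma exists_norm_iteratedFDeriv_le (hn : 5 ≤ n) : ∃ C : ℝ, 0 ≤ C ∧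
    ∀ (W : E → ℝ) (B : ℝ), ContDiff ℝ 4 W → (∀ y ∈ closedBall (0 : E) 1, |W y| ≤ B) →
      (∀ y ∈ closedBall (0 : E) 1, |bilap W y| ≤ B) →
      ∀ j ≤ 3, ‖iteratedFDeriv ℝ j W 0‖ ≤ C * B := by
  have hpos := integral_rho_pos hn
  choose Cr hr0 hr using exists_integral_abs_ipd_le (contDiff_rho (n := n)) tsupport_rho
  choose Ck hk0 hk using exists_integral_abs_ipd_le (contDiff_kap (n := n)) tsupport_kap
  refine ⟨∑ j ∈ Finset.range 4, (Cr j + Ck j) / ∫ y : E, rho y,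
    Finset.sum_nonneg fun j _ => div_nonneg (add_nonneg (hr0 j) (hk0 j)) hpos.le,
    fun W B hW hB hB' j hj => ?_⟩
  have hB0 : 0 ≤ B := (abs_nonneg _).trans (hB 0 (by simp))
  have hle : (Cr j + Ck j) / (∫ y : E, rho y) ≤
      ∑ j ∈ Finset.range 4, (Cr j + Ck j) / ∫ y : E, rho y :=
    Finset.single_le_sum (f := fun j => (Cr j + Ck j) / ∫ y : E, rho y)
      (fun j _ => div_nonneg (add_nonneg (hr0 j) (hk0 j)) hpos.le)
      (Finset.mem_range.2 (by omega))
  refine le_trans ?_ (mul_le_mul_of_nonneg_right hle hB0)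
  refine ContinuousMultilinearMap.opNorm_le_bound
    (mul_nonneg (div_nonneg (add_nonneg (hr0 j) (hk0 j)) hpos.le) hB0) fun m => ?_
  rw [iteratedFDeriv_apply_eq_ipd j (hW.of_le (by exact_mod_cast hj.trans (by norm_num))) m,
    Real.norm_eq_abs]
  have h := abs_ipd_le hW (List.ofFn m) (by simpa using hj) hB hB'
  have h2 : B * ((∫ y : E, |ipd (List.ofFn m) rho y|) + ∫ y : E, |ipd (List.ofFn m) kap y|) ≤
      B * (Cr j * ∏ i, ‖m i‖ + Ck j * ∏ i, ‖m i‖) :=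
    mul_le_mul_of_nonneg_left (add_le_add (hr j m) (hk j m)) hB0
  rw [← mul_le_mul_iff_right₀ hpos]
  refine (h.trans h2).trans (le_of_eq ?_)
  field_simp

end Formula

section TestFunction

variable {n : ℕ}

local notation "E" => EuclideanSpace ℝ (Fin n)

lemma exists_pd_pow_mul {η g : E → ℝ} (hη : ContDiff ℝ ∞ η) (hg : ContDiff ℝ ∞ g) (k : ℕ) (e : E) :
    ∃ g' : E → ℝ, ContDiff ℝ ∞ g' ∧
      pd e (fun x => η x ^ (k + 1) * g x) = fun x => η x ^ k * g' x := by
  have h1 : ContDiff ℝ ∞ (pd e η) := contDiff_pd hη (by simp) e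
  have h2 : ContDiff ℝ ∞ (pd e g) := contDiff_pd hg (by simp) e
  refine ⟨fun x => (k + 1) * pd e η x * g x + η x * pd e g x, by fun_prop, ?_⟩
  funext x
  have d1 : HasFDerivAt η (fderiv ℝ η x) x := (hη.differentiable (by simp) x).hasFDerivAt
  have d2 : HasFDerivAt g (fderiv ℝ g x) x := (hg.differentiable (by simp) x).hasFDerivAt
  have d3 := ((d1.pow (k + 1)).mul d2).fderiv
  have : (fun x => η x ^ (k + 1) * g x) = (fun x => η x ^ (k + 1)) * g := rfl
  rw [this]
  unfold pd
  rw [d3]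
  simp
  ring

lemma exists_lap_pow_mul {η g : E → ℝ} (hη : ContDiff ℝ ∞ η) (hg : ContDiff ℝ ∞ g) (k : ℕ) :
    ∃ g' : E → ℝ, ContDiff ℝ ∞ g' ∧
      lap (fun x => η x ^ (k + 2) * g x) = fun x => η x ^ k * g' x := by
  have h : ∀ i : Fin n, ∃ g' : E → ℝ, ContDiff ℝ ∞ g' ∧
      pd (bvec i) (pd (bvec i) (fun x => η x ^ (k + 2) * g x)) = fun x => η x ^ k * g' x := by
    intro i
    obtain ⟨g1, hg1, e1⟩ := exists_pd_pow_mul hη hg (k + 1) (bvec i)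
    obtain ⟨g2, hg2, e2⟩ := exists_pd_pow_mul hη hg1 k (bvec i)
    exact ⟨g2, hg2, by rw [e1, e2]⟩
  choose G hG eG using h
  refine ⟨fun x => ∑ i, G i x, ContDiff.sum fun i _ => hG i, ?_⟩
  have hc : ContDiff ℝ ∞ (fun x => η x ^ (k + 2) * g x) := by fun_prop
  rw [lap_eq (hc.of_le (natCast_le_infty 2))]
  funext x
  rw [Finset.mul_sum]
  exact Finset.sum_congr rfl fun i _ => congrFun (eG i) x

lemma exists_bilap_pow {η : E → ℝ} (hη : ContDiff ℝ ∞ η) (k : ℕ) :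
    ∃ g' : E → ℝ, ContDiff ℝ ∞ g' ∧
      bilap (fun x => η x ^ (k + 4)) = fun x => η x ^ k * g' x := by
  obtain ⟨g1, hg1, e1⟩ := exists_lap_pow_mul hη (contDiff_const (c := (1 : ℝ))) (k + 2)
  obtain ⟨g2, hg2, e2⟩ := exists_lap_pow_mul hη hg1 k
  refine ⟨g2, hg2, ?_⟩
  simp only [mul_one] at e1
  unfold bilap
  rw [e1, e2]

lemma exists_mul_le_half_rpow_add {p : ℝ} (hp : 1 < p) {C : ℝ} (hC : 0 ≤ C) :
    ∃ K : ℝ, 0 ≤ K ∧ ∀ a : ℝ, 0 ≤ a → C * a ≤ 1 / 2 * a ^ p + K := by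
  refine ⟨C * (2 * C) ^ (1 / (p - 1)), by positivity, fun a ha => ?_⟩
  rcases le_or_gt a ((2 * C) ^ (1 / (p - 1))) with h | h
  · have := mul_le_mul_of_nonneg_left h hC
    have := Real.rpow_nonneg ha p
    linarith
  · have ha' : 0 < a := lt_of_le_of_lt (by positivity) h
    have hp' : 0 < p - 1 := by linarith
    have h1 : 2 * C ≤ a ^ (p - 1) := by
      have := Real.rpow_le_rpow (by positivity) h.le hp'.le
      rwa [← Real.rpow_mul (by positivity), one_div_mul_cancel hp'.ne', Real.rpow_one] at this
    have h2 : a ^ p = a ^ (p - 1) * a := by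
      rw [Real.rpow_sub_one ha'.ne', div_mul_cancel₀ _ ha'.ne']
    have h3 := mul_le_mul_of_nonneg_right h1 ha
    have : 0 ≤ C * (2 * C) ^ (1 / (p - 1)) := by positivity
    rw [h2]
    linarith

lemma exists_abs_integral_mul_rho_le {p : ℝ} (hp : 1 < p) : ∃ C : ℝ, 0 ≤ C ∧
    ∀ W : E → ℝ, ContDiff ℝ 4 W → (∀ y ∈ ball (0 : E) 2, 0 ≤ W y) →
      (∀ y ∈ ball (0 : E) 2, bilap W y = W y ^ p) → |∫ y, W y * rho y| ≤ C := by
  let b : ContDiffBump (0 : E) := ⟨1, 2, one_pos, one_lt_two⟩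
  have hη : ContDiff ℝ ∞ b := b.contDiff
  obtain ⟨k, hk⟩ := exists_nat_ge (4 / (p - 1))
  have hp' : 0 < p - 1 := by linarith
  have hp0 : 0 < p := by linarith
  rw [div_le_iff₀ hp'] at hk
  have hk0 : k ≠ 0 := by rintro rfl; norm_num at hk
  obtain ⟨g, hg, eg⟩ := exists_bilap_pow hη k
  have hgc := hg.continuous
  have hrc := (contDiff_rho (n := n)).continuous
  obtain ⟨C, hC⟩ := (isCompact_closedBall (0 : E) 2).exists_bound_of_continuousOn hgc.continuousOn
  obtain ⟨D, hD⟩ := (isCompact_closedBall (0 : E) 2).exists_bound_of_continuousOn hrc.continuousOn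
  have hC0 : 0 ≤ C := (norm_nonneg _).trans (hC 0 (by simp))
  have hD0 : 0 ≤ D := (norm_nonneg _).trans (hD 0 (by simp))
  obtain ⟨K, hK0, hK⟩ := exists_mul_le_half_rpow_add hp hC0
  obtain ⟨K', hK0', hK'⟩ := exists_mul_le_half_rpow_add hp hD0
  set V := (volume : Measure E).real (closedBall 0 2) with hV
  have hV0 : 0 ≤ V := measureReal_nonneg
  refine ⟨K * V + K' * V, by positivity, fun W hW hW0 hWp => ?_⟩
  have hWc := hW.continuous
  have hbz : ∀ y ∉ ball (0 : E) 2, b y = 0 := fun y hy =>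
    b.zero_of_le_dist (by simpa using hy)
  have hψs : HasCompactSupport fun y => b y ^ (k + 4) := by
    refine HasCompactSupport.intro (isCompact_closedBall (0 : E) 2) fun y hy => ?_
    rw [hbz y fun h => hy (ball_subset_closedBall h)]; simp
  have i1 : Integrable fun y => W y ^ p * b y ^ (k + 4) :=
    Continuous.integrable_of_hasCompactSupport
      (((hWc.rpow_const fun _ => Or.inr hp0.le)).mul (b.continuous.pow _)) hψs.mul_left
  have hind : ∀ c : ℝ, Integrable ((closedBall (0 : E) 2).indicator fun _ => c) := fun c =>
    (integrable_indicator_iff measurableSet_closedBall).2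
      (integrableOn_const measure_closedBall_lt_top.ne)
  have hind' : ∀ c : ℝ, ∫ y, (closedBall (0 : E) 2).indicator (fun _ => c) y = c * V := fun c => by
    rw [integral_indicator measurableSet_closedBall, setIntegral_const, smul_eq_mul, mul_comm]
  have key : ∀ y, (b y ^ k * W y) ^ p * (ball (0 : E) 2).indicator (fun _ => 1) y ≤
      W y ^ p * b y ^ (k + 4) := by
    intro y
    by_cases hy : y ∈ ball (0 : E) 2
    · rw [Set.indicator_of_mem hy, mul_one, Real.mul_rpow (pow_nonneg b.nonneg _) (hW0 y hy),
        mul_comm]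
      refine mul_le_mul_of_nonneg_left ?_ (Real.rpow_nonneg (hW0 y hy) _)
      rw [← Real.rpow_natCast, ← Real.rpow_natCast, ← Real.rpow_mul b.nonneg]
      refine Real.rpow_le_rpow_of_exponent_ge (b.pos_of_mem_ball hy) b.le_one ?_
      push_cast
      linarith
    · rw [Set.indicator_of_notMem hy, hbz y hy]; simp
  have hmain : ∫ y, W y ^ p * b y ^ (k + 4) = ∫ y, W y * (b y ^ k * g y) := by
    have h1 := integral_bilap_mul hW ((hη.pow (k + 4)).of_le (natCast_le_infty 4)) hψs
    rw [eg] at h1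
    rw [← h1]
    refine integral_congr_ae (Eventually.of_forall fun y => ?_)
    by_cases hy : y ∈ ball (0 : E) 2
    · simp only [hWp y hy]
    · simp [hbz y hy]
  have hle : ∫ y, W y ^ p * b y ^ (k + 4) ≤
      1 / 2 * (∫ y, W y ^ p * b y ^ (k + 4)) + K * V := by
    nth_rewrite 1 [hmain]
    rw [← hind' K, ← integral_const_mul, ← integral_add (i1.const_mul _) (hind K)]
    refine integral_mono ?_ ((i1.const_mul _).add (hind K)) fun y => ?_
    · refine Continuous.integrable_of_hasCompactSupport
        (hWc.mul ((b.continuous.pow _).mul hgc)) ?_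
      refine HasCompactSupport.intro (isCompact_closedBall (0 : E) 2) fun y hy => ?_
      rw [hbz y fun h => hy (ball_subset_closedBall h)]; simp [hk0]
    · by_cases hy : y ∈ ball (0 : E) 2
      · have hy' := ball_subset_closedBall hy
        simp only [Set.indicator_of_mem hy']
        have h1 := key y
        rw [Set.indicator_of_mem hy, mul_one] at h1
        have h2 := hK (b y ^ k * W y) (mul_nonneg (pow_nonneg b.nonneg _) (hW0 y hy))
        have h3 : W y * (b y ^ k * g y) ≤ C * (b y ^ k * W y) := by
          have := (le_abs_self _).trans (hC y hy')
          have := mul_le_mul_of_nonneg_right this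
            (mul_nonneg (pow_nonneg b.nonneg k) (hW0 y hy) : 0 ≤ b y ^ k * W y)
          linarith
        linarith
      · simp only [hbz y hy, ne_eq, hk0, not_false_eq_true, zero_pow, zero_mul, mul_zero]
        have := Set.indicator_nonneg (s := closedBall (0 : E) 2) (f := fun _ => K)
          (fun _ _ => hK0) y
        simpa using this
  have hle2 : |∫ y, W y * rho y| ≤
      1 / 2 * (∫ y, W y ^ p * b y ^ (k + 4)) + K' * V := by
    rw [← hind' K', ← integral_const_mul, ← integral_add (i1.const_mul _) (hind K'),
      ← Real.norm_eq_abs]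
    refine norm_integral_le_of_norm_le ((i1.const_mul _).add (hind K'))
      (Eventually.of_forall fun y => ?_)
    by_cases hy1 : y ∈ closedBall (0 : E) 1
    · have hy : y ∈ ball (0 : E) 2 := closedBall_subset_ball one_lt_two hy1
      have hy' := ball_subset_closedBall hy
      simp only [Set.indicator_of_mem hy']
      rw [b.one_of_mem_closedBall hy1, one_pow, mul_one, norm_mul, Real.norm_of_nonneg (hW0 y hy)]
      have h2 := hK' (W y) (hW0 y hy)
      have h3 := mul_le_mul_of_nonneg_right (hD y hy') (hW0 y hy)
      linarith
    · rw [mem_closedBall_zero_iff, not_le] at hy1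
      rw [rho_eq_zero hy1.le, mul_zero, norm_zero]
      have h1 := Set.indicator_nonneg (s := closedBall (0 : E) 2) (f := fun _ => K')
        (fun _ _ => hK0') y
      refine add_nonneg ?_ h1
      by_cases hy : y ∈ ball (0 : E) 2
      · have := hW0 y hy
        have := b.nonneg (x := y)
        positivity
      · simp [hbz y hy]
  linarith

lemma exists_abs_sub_integral_le {p : ℝ} (hp : 1 < p) : ∃ C : ℝ, 0 ≤ C ∧
    ∀ (W : E → ℝ) (x : E) (R : ℝ), 0 < R → ContDiff ℝ 4 W → (∀ y ∈ ball x (2 * R), 0 ≤ W y) →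
      (∀ y ∈ ball x (2 * R), bilap W y = W y ^ p) →
      |(∫ y : E, rho y) * W x - ∫ t in (0 : ℝ)..R, t ^ 3 * ∫ y, W (x + t • y) ^ p * kap y| ≤
        C * R ^ (-(4 / (p - 1))) := by
  obtain ⟨C, hC0, hC⟩ := exists_abs_integral_mul_rho_le (n := n) hp
  have hp' : p - 1 ≠ 0 := by linarith
  refine ⟨C, hC0, fun W x R hR hW hW0 hWp => ?_⟩
  set s := 4 / (p - 1) with hs
  have hsp : s + 4 = s * p := by rw [hs]; field_simp; ring
  have hRs : 0 < R ^ s := Real.rpow_pos_of_pos hR s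
  have hmem : ∀ y ∈ ball (0 : E) 2, x + R • y ∈ ball x (2 * R) := fun y hy => by
    rw [mem_ball_zero_iff] at hy
    rw [mem_ball_iff_norm, add_sub_cancel_left, norm_smul, Real.norm_of_nonneg hR.le, mul_comm]
    exact mul_lt_mul_of_pos_right hy hR
  have h1 := hC (fun y => R ^ s * W (x + R • y)) (by fun_prop)
    (fun y hy => mul_nonneg hRs.le (hW0 _ (hmem y hy))) (fun y hy => by
      rw [bilap_comp hW]
      simp only
      rw [hWp _ (hmem y hy), Real.mul_rpow hRs.le (hW0 _ (hmem y hy)), ← Real.rpow_mul hR.le, ← hsp,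
        Real.rpow_add hR]
      norm_num)
  simp only [mul_assoc] at h1
  rw [integral_const_mul, abs_mul, abs_of_pos hRs] at h1
  have h2 := representation (W := fun y => W (x + y)) (by fun_prop) hR.le
  have e1 : bilap (fun y => W (x + y)) = fun y => bilap W (x + y) := by
    simpa using bilap_comp hW x 1 1
  rw [e1] at h2
  simp only [add_zero] at h2
  have e2 : ∫ t in (0 : ℝ)..R, t ^ 3 * ∫ y, bilap W (x + t • y) * kap y =
      ∫ t in (0 : ℝ)..R, t ^ 3 * ∫ y, W (x + t • y) ^ p * kap y := by
    refine intervalIntegral.integral_congr fun t ht => ?_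
    rw [Set.uIcc_of_le hR.le] at ht
    congr 1
    refine integral_congr_ae (Eventually.of_forall fun y => ?_)
    simp only
    rcases le_or_gt 1 ‖y‖ with hy | hy
    · rw [kap_eq_zero hy]; simp
    · rw [hWp]
      rw [mem_ball_iff_norm, add_sub_cancel_left, norm_smul, Real.norm_of_nonneg ht.1]
      nlinarith [ht.1, ht.2, norm_nonneg y]
  rw [h2, e2, add_sub_cancel_right, Real.rpow_neg hR.le, ← div_eq_mul_inv, le_div_iff₀ hRs, mul_comm]
  exact h1

end TestFunction

section Compactness

variable {n : ℕ}

local notation "E" => EuclideanSpace ℝ (Fin n)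

lemma exists_subseq_tendsto_of_lipschitz {W : ℕ → E → ℝ} {M L : ℝ}
    (hW0 : ∀ x, ∀ᶠ k in atTop, 0 ≤ W k x) (hWM : ∀ x, ∀ᶠ k in atTop, W k x ≤ M)
    (hL : ∀ x y, ∀ᶠ k in atTop, |W k x - W k y| ≤ L * ‖x - y‖) :
    ∃ (v : E → ℝ) (φ : ℕ → ℕ), StrictMono φ ∧ ∀ x, Tendsto (fun k => W (φ k) x) atTop (𝓝 (v x)) := by
  have hL' : ∀ x y, ∀ᶠ k in atTop, |W k x - W k y| ≤ |L| * ‖x - y‖ := fun x y => by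
    filter_upwards [hL x y] with k hk
    exact hk.trans (mul_le_mul_of_nonneg_right (le_abs_self L) (norm_nonneg _))
  have hM0 : 0 ≤ M := by
    obtain ⟨k, h1, h2⟩ := ((hW0 0).and (hWM 0)).exists
    exact h1.trans h2
  let d := TopologicalSpace.denseSeq E
  obtain ⟨f, -, φ, hφ, hf⟩ := (isCompact_univ_pi fun _ : ℕ => isCompact_Icc (a := (0 : ℝ))
    (b := M)).tendsto_subseq (x := fun k i => max 0 (min M (W k (d i))))
    (fun k i _ => ⟨le_max_left _ _, max_le hM0 (min_le_left _ _)⟩)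
  have hd : ∀ i, Tendsto (fun k => W (φ k) (d i)) atTop (𝓝 (f i)) := fun i => by
    refine ((tendsto_pi_nhds.1 hf) i).congr' ?_
    filter_upwards [hφ.tendsto_atTop.eventually (hW0 (d i)),
      hφ.tendsto_atTop.eventually (hWM (d i))] with k h1 h2
    simp [h1, h2]
  have hc : ∀ x, ∃ l, Tendsto (fun k => W (φ k) x) atTop (𝓝 l) := fun x => by
    refine cauchySeq_tendsto_of_complete (Metric.cauchySeq_iff'.2 fun ε hε => ?_)
    obtain ⟨i, hi⟩ := (TopologicalSpace.denseRange_denseSeq E).exists_dist_lt x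
      (show 0 < ε / (4 * (|L| + 1)) by positivity)
    have h1 : |L| * ‖x - d i‖ < ε / 4 := by
      rw [dist_eq_norm, lt_div_iff₀ (by positivity)] at hi
      nlinarith [norm_nonneg (x - d i), abs_nonneg L]
    obtain ⟨N, hN⟩ := eventually_atTop.1 (((Metric.tendsto_nhds.1 (hd i)) (ε / 4)
      (by positivity)).and (hφ.tendsto_atTop.eventually (hL' x (d i))))
    refine ⟨N, fun k hk => ?_⟩
    obtain ⟨a1, b1⟩ := hN k hk
    obtain ⟨a2, b2⟩ := hN N le_rfl
    rw [Real.dist_eq, abs_lt] at *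
    have b1' := abs_le.1 b1
    have b2' := abs_le.1 b2
    constructor <;> linarith
  choose v hv using hc
  exact ⟨v, φ, hφ, hv⟩

lemma integrable_kap : Integrable (kap : E → ℝ) :=
  contDiff_kap.continuous.integrable_of_hasCompactSupport hasCompactSupport_kap

lemma tendsto_integral_kap {W : ℕ → E → ℝ} {v : E → ℝ} {M p : ℝ} (hp : 0 < p)
    (hWc : ∀ k, Continuous (W k))
    (hW0 : ∀ᶠ k : ℕ in atTop, ∀ y ∈ ball (0 : E) k, 0 ≤ W k y)
    (hWM : ∀ᶠ k : ℕ in atTop, ∀ y ∈ ball (0 : E) k, W k y ≤ M)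
    {φ : ℕ → ℕ} (hφ : StrictMono φ)
    (hv : ∀ x, Tendsto (fun k => W (φ k) x) atTop (𝓝 (v x))) (x : E) {R : ℝ} (hR : 0 < R) :
    Tendsto (fun k => ∫ t in (0 : ℝ)..R, t ^ 3 * ∫ y, W (φ k) (x + t • y) ^ p * kap y) atTop
      (𝓝 (∫ t in (0 : ℝ)..R, t ^ 3 * ∫ y, v (x + t • y) ^ p * kap y)) := by
  have hkc := (contDiff_kap (n := n)).continuous
  have hWpc : ∀ k, Continuous fun y => W k y ^ p := fun k =>
    (hWc k).rpow_const fun _ => Or.inr hp.le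
  have hbd : ∀ᶠ k in atTop, ∀ t ∈ Set.Icc (0 : ℝ) R, ∀ y,
      ‖W (φ k) (x + t • y) ^ p * kap y‖ ≤ M ^ p * kap y := by
    filter_upwards [hφ.tendsto_atTop.eventually hW0, hφ.tendsto_atTop.eventually hWM,
      (tendsto_natCast_atTop_atTop (R := ℝ).comp hφ.tendsto_atTop).eventually_gt_atTop
        (‖x‖ + R)] with k h0 h1 h2 t ht y
    simp only [Function.comp_apply] at h2
    rcases le_or_gt 1 ‖y‖ with hy | hy
    · simp [kap_eq_zero hy]
    · have hm : x + t • y ∈ ball (0 : E) (φ k) := by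
        rw [mem_ball_zero_iff]
        refine (norm_add_le _ _).trans_lt ?_
        rw [norm_smul, Real.norm_of_nonneg ht.1]
        nlinarith [ht.1, ht.2, norm_nonneg y]
      rw [norm_mul, Real.norm_of_nonneg (kap_nonneg y),
        Real.norm_of_nonneg (Real.rpow_nonneg (h0 _ hm) _)]
      exact mul_le_mul_of_nonneg_right (Real.rpow_le_rpow (h0 _ hm) (h1 _ hm) hp.le) (kap_nonneg y)
  refine intervalIntegral.tendsto_integral_filter_of_dominated_convergence
    (fun _ => R ^ 3 * (M ^ p * ∫ y : E, kap y)) ?_ ?_ (by simp) ?_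
  · refine Eventually.of_forall fun k => Continuous.aestronglyMeasurable ?_
    have := continuous_integral_comp_smul_mul (hWpc (φ k)) hkc (fun y => kap_eq_zero) x
    fun_prop
  · filter_upwards [hbd] with k hk
    refine Eventually.of_forall fun t ht => ?_
    rw [Set.uIoc_of_le hR.le] at ht
    have h1 := norm_integral_le_of_norm_le (integrable_kap.const_mul (M ^ p))
      (Eventually.of_forall (hk t ⟨ht.1.le, ht.2⟩))
    rw [integral_const_mul] at h1
    rw [norm_mul, Real.norm_of_nonneg (pow_nonneg ht.1.le 3)]
    exact mul_le_mul (pow_le_pow_left₀ ht.1.le ht.2 3) h1 (norm_nonneg _) (pow_nonneg hR.le 3)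
  · refine Eventually.of_forall fun t ht => ?_
    rw [Set.uIoc_of_le hR.le] at ht
    refine Tendsto.const_mul _ ?_
    refine tendsto_integral_filter_of_dominated_convergence (fun y => M ^ p * kap y) ?_ ?_
      (integrable_kap.const_mul _) ?_
    · refine Eventually.of_forall fun k => Continuous.aestronglyMeasurable ?_
      have := hWpc (φ k)
      exact (this.comp (by fun_prop)).mul hkc
    · filter_upwards [hbd] with k hk
      exact Eventually.of_forall (hk t ⟨ht.1.le, ht.2⟩)
    · exact Eventually.of_forall fun y =>
        (((Real.continuousAt_rpow_const _ _ (Or.inr hp.le)).tendsto.comp (hv _)).mul_const _)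

lemma exists_limit (hn : 5 ≤ n) {p : ℝ} (hp : 1 < p) {M : ℝ} {W : ℕ → E → ℝ}
    (hW : ∀ k, ContDiff ℝ 4 (W k)) (hW0 : ∀ k : ℕ, ∀ y ∈ ball (0 : E) k, 0 ≤ W k y)
    (hWM : ∀ k : ℕ, ∀ y ∈ ball (0 : E) k, W k y ≤ M)
    (hWp : ∀ k : ℕ, ∀ y ∈ ball (0 : E) k, bilap (W k) y = W k y ^ p)
    (hW1 : ∀ k, W k 0 = 1) :
    ∃ (v : E → ℝ) (C : ℝ), Continuous v ∧ (∀ x, 0 ≤ v x) ∧ (∀ x, v x ≤ M) ∧ v 0 = 1 ∧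
      ∀ (x : E) (R : ℝ), 0 < R →
      |(∫ y : E, rho y) * v x - ∫ t in (0 : ℝ)..R, t ^ 3 * ∫ y, v (x + t • y) ^ p * kap y| ≤
        C * R ^ (-(4 / (p - 1))) := by
  have hp0 : 0 < p := by linarith
  obtain ⟨C₀, hC₀, hder⟩ := exists_norm_iteratedFDeriv_le hn
  obtain ⟨C, hC, hrep⟩ := exists_abs_sub_integral_le (n := n) hp
  set L := C₀ * max M (M ^ p) with hLdef
  have hmem : ∀ x : E, ∀ᶠ k : ℕ in atTop, x ∈ ball (0 : E) k := fun x => by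
    filter_upwards [(tendsto_natCast_atTop_atTop (R := ℝ)).eventually_gt_atTop ‖x‖] with k hk
    simpa using hk
  have hfd : ∀ (k : ℕ) (x : E), ‖x‖ + 1 < k → ‖fderiv ℝ (W k) x‖ ≤ L := by
    intro k x hk
    have hb : ∀ y ∈ closedBall (0 : E) 1, x + y ∈ ball (0 : E) k := fun y hy => by
      rw [mem_closedBall_zero_iff] at hy
      rw [mem_ball_zero_iff]
      have := norm_add_le x y
      linarith
    have e1 : bilap (fun y => W k (x + y)) = fun y => bilap (W k) (x + y) := by
      simpa using bilap_comp (hW k) x 1 1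
    have h := hder (fun y => W k (x + y)) (max M (M ^ p))
      ((hW k).comp (contDiff_const.add contDiff_id))
      (fun y hy => by
        rw [abs_of_nonneg (hW0 k _ (hb y hy))]
        exact (hWM k _ (hb y hy)).trans (le_max_left _ _))
      (fun y hy => by
        rw [e1]
        simp only
        rw [hWp k _ (hb y hy), abs_of_nonneg (Real.rpow_nonneg (hW0 k _ (hb y hy)) _)]
        exact (Real.rpow_le_rpow (hW0 k _ (hb y hy)) (hWM k _ (hb y hy)) hp0.le).trans
          (le_max_right _ _)) 1 (by norm_num)
    rw [norm_iteratedFDeriv_one, fderiv_comp_add_left, add_zero] at h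
    exact h
  have hlip : ∀ x y, ∀ᶠ k in atTop, |W k x - W k y| ≤ L * ‖x - y‖ := fun x y => by
    filter_upwards [(tendsto_natCast_atTop_atTop (R := ℝ)).eventually_gt_atTop
      (max ‖x‖ ‖y‖ + 1)] with k hk
    have hx : x ∈ closedBall (0 : E) (max ‖x‖ ‖y‖) := by simp
    have hy : y ∈ closedBall (0 : E) (max ‖x‖ ‖y‖) := by simp
    refine (convex_closedBall (0 : E) (max ‖x‖ ‖y‖)).norm_image_sub_le_of_norm_fderiv_le (𝕜 := ℝ)
      (fun z _ => (hW k).differentiable (by norm_num) z) (fun z hz => hfd k z ?_) hy hx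
    rw [mem_closedBall_zero_iff] at hz
    linarith
  have h0 : ∀ x, ∀ᶠ k in atTop, 0 ≤ W k x := fun x => (hmem x).mono fun k hk => hW0 k x hk
  have hM : ∀ x, ∀ᶠ k in atTop, W k x ≤ M := fun x => (hmem x).mono fun k hk => hWM k x hk
  obtain ⟨v, φ, hφ, hv⟩ := exists_subseq_tendsto_of_lipschitz h0 hM hlip
  have hvL : ∀ x y, |v x - v y| ≤ L * ‖x - y‖ := fun x y =>
    le_of_tendsto ((hv x).sub (hv y)).abs (hφ.tendsto_atTop.eventually (hlip x y))
  refine ⟨v, C, ?_, fun x => ge_of_tendsto (hv x) (hφ.tendsto_atTop.eventually (h0 x)),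
    fun x => le_of_tendsto (hv x) (hφ.tendsto_atTop.eventually (hM x)), ?_, fun x R hR => ?_⟩
  · refine (LipschitzWith.of_dist_le_mul (K := ⟨|L|, abs_nonneg L⟩) fun x y => ?_).continuous
    rw [Real.dist_eq, dist_eq_norm]
    exact (hvL x y).trans (mul_le_mul_of_nonneg_right (le_abs_self L) (norm_nonneg _))
  · exact tendsto_nhds_unique (hv 0) (by simp [hW1])
  · refine le_of_tendsto (((hv x).const_mul _).sub (tendsto_integral_kap hp0
      (fun k => (hW k).continuous) (Eventually.of_forall hW0) (Eventually.of_forall hWM)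
      hφ hv x hR)).abs ?_
    filter_upwards [(tendsto_natCast_atTop_atTop (R := ℝ).comp
      hφ.tendsto_atTop).eventually_gt_atTop (‖x‖ + 2 * R)] with k hk
    have hb : ∀ y ∈ ball x (2 * R), y ∈ ball (0 : E) (φ k) := fun y hy => by
      rw [mem_ball_iff_norm] at hy
      rw [mem_ball_zero_iff]
      have := norm_le_norm_add_norm_sub x y
      rw [norm_sub_rev] at this
      simp only [Function.comp_apply] at hk
      linarith
    exact hrep (W (φ k)) x R hR (hW _) (fun y hy => hW0 _ y (hb y hy))
      fun y hy => hWp _ y (hb y hy)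

end Compactness

section IntegralEquation

lemma lintegral_comp_smul_of_pos {F : Type*} [NormedAddCommGroup F] [NormedSpace ℝ F]
    [FiniteDimensional ℝ F] [MeasurableSpace F] [BorelSpace F] (μ : Measure F) [μ.IsAddHaarMeasure]
    (f : F → ENNReal) {t : ℝ} (ht : 0 < t) :
    ∫⁻ y, f (t • y) ∂μ = ENNReal.ofReal (t ^ Module.finrank ℝ F)⁻¹ * ∫⁻ y, f y ∂μ := by
  have h := (Homeomorph.smulOfNeZero t ht.ne' : F ≃ₜ F).measurableEmbedding.lintegral_map
    (μ := μ) f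
  have e : Measure.map (Homeomorph.smulOfNeZero t ht.ne' : F ≃ₜ F) μ =
      ENNReal.ofReal (abs (t ^ Module.finrank ℝ F)⁻¹) • μ := Measure.map_addHaar_smul μ ht.ne'
  rw [e, lintegral_smul_measure, abs_of_pos (by positivity)] at h
  exact h.symm

lemma lintegral_comp_add_smul_of_pos {F : Type*} [NormedAddCommGroup F] [NormedSpace ℝ F]
    [FiniteDimensional ℝ F] [MeasurableSpace F] [BorelSpace F] (μ : Measure F) [μ.IsAddHaarMeasure]
    (f : F → ENNReal) (x : F) {t : ℝ} (ht : 0 < t) :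
    ∫⁻ y, f (x + t • y) ∂μ = ENNReal.ofReal (t ^ Module.finrank ℝ F)⁻¹ * ∫⁻ y, f y ∂μ := by
  rw [lintegral_comp_smul_of_pos μ (fun y => f (x + y)) ht, lintegral_add_left_eq_self f x]

/-- The constant arising from averaging the truncated kernel over all scales. -/
noncomputable def scaleConst (n : ℕ) : ENNReal :=
  ∫⁻ t in Set.Ioi (0 : ℝ), ENNReal.ofReal (t ^ 3 * (t ^ n)⁻¹ * prof ((1 / t) ^ 2))

lemma lintegral_scale {n : ℕ} (hn : 4 ≤ n) {r : ℝ} (hr : 0 < r) :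
    ∫⁻ t in Set.Ioi (0 : ℝ), ENNReal.ofReal (t ^ 3 * (t ^ n)⁻¹ * prof ((r / t) ^ 2)) =
      ENNReal.ofReal (r ^ (n - 4))⁻¹ * scaleConst n := by
  unfold scaleConst
  rw [← lintegral_indicator measurableSet_Ioi, ← lintegral_indicator measurableSet_Ioi]
  set f := (Set.Ioi (0 : ℝ)).indicator fun t =>
    ENNReal.ofReal (t ^ 3 * (t ^ n)⁻¹ * prof ((r / t) ^ 2)) with hf
  have h1 := lintegral_comp_smul_of_pos (volume : Measure ℝ) f hr
  have h2 : ∀ t, f (r • t) = ENNReal.ofReal (r ^ 3 * (r ^ n)⁻¹) * (Set.Ioi (0 : ℝ)).indicator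
      (fun t => ENNReal.ofReal (t ^ 3 * (t ^ n)⁻¹ * prof ((1 / t) ^ 2))) t := by
    intro t
    rw [smul_eq_mul]
    by_cases ht : t ∈ Set.Ioi (0 : ℝ)
    · have ht' : 0 < t := ht
      have hrt : r * t ∈ Set.Ioi (0 : ℝ) := mul_pos hr ht
      rw [hf, Set.indicator_of_mem hrt, Set.indicator_of_mem ht, ← ENNReal.ofReal_mul (by positivity)]
      congr 1
      have : r / (r * t) = 1 / t := by field_simp
      rw [this, mul_pow, mul_pow, mul_inv]
      ring
    · have hrt : r * t ∉ Set.Ioi (0 : ℝ) := fun h => ht (pos_of_mul_pos_right h hr.le)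
      rw [hf, Set.indicator_of_notMem hrt, Set.indicator_of_notMem ht, mul_zero]
  simp only [h2] at h1
  rw [lintegral_const_mul' _ _ ENNReal.ofReal_ne_top, Module.finrank_self, pow_one] at h1
  have h3 : ∀ a : ENNReal, a = ENNReal.ofReal r * (ENNReal.ofReal r⁻¹ * a) := fun a => by
    rw [← mul_assoc, ← ENNReal.ofReal_mul hr.le, mul_inv_cancel₀ hr.ne', ENNReal.ofReal_one, one_mul]
  rw [h3 (∫⁻ t, f t), ← h1, ← mul_assoc, ← ENNReal.ofReal_mul hr.le]
  congr 2
  obtain ⟨m, rfl⟩ := Nat.exists_eq_add_of_le hn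
  rw [Nat.add_sub_cancel_left, pow_add]
  field_simp

lemma scaleConst_ne_top {n : ℕ} (hn : 5 ≤ n) : scaleConst n ≠ ⊤ := by
  have hi : IntegrableOn (fun t : ℝ => t ^ (-2 : ℝ)) (Set.Ioi 1) :=
    integrableOn_Ioi_rpow_of_lt (by norm_num) one_pos
  have h2 : ∫⁻ t in Set.Ioi (1 : ℝ), ENNReal.ofReal (t ^ (-2 : ℝ)) < ⊤ := hi.lintegral_lt_top
  refine (lt_of_le_of_lt ?_ h2).ne
  unfold scaleConst
  rw [← lintegral_indicator measurableSet_Ioi, ← lintegral_indicator measurableSet_Ioi]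
  refine lintegral_mono fun t => ?_
  by_cases ht : t ∈ Set.Ioi (1 : ℝ)
  · have ht1 : 1 < t := ht
    have ht0 : t ∈ Set.Ioi (0 : ℝ) := lt_trans one_pos ht1
    have ht0' : 0 < t := ht0
    rw [Set.indicator_of_mem ht, Set.indicator_of_mem ht0]
    refine ENNReal.ofReal_le_ofReal ?_
    obtain ⟨m, rfl⟩ := Nat.exists_eq_add_of_le hn
    have h1 : prof ((1 / t) ^ 2) ≤ 1 := Real.smoothTransition.le_one _
    have h3 : t ^ 3 * (t ^ (5 + m))⁻¹ ≤ t ^ (-2 : ℝ) := by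
      rw [Real.rpow_neg ht0'.le, Real.rpow_ofNat, pow_add, ← div_eq_mul_inv, div_le_iff₀ (by positivity),
        inv_mul_eq_div, le_div_iff₀ (by positivity)]
      have := one_le_pow₀ (n := m) ht1.le
      nlinarith [pow_pos ht0' 5]
    calc _ ≤ t ^ 3 * (t ^ (5 + m))⁻¹ * 1 := by gcongr
      _ ≤ _ := by rwa [mul_one]
  · rw [Set.indicator_of_notMem ht]
    by_cases ht0 : t ∈ Set.Ioi (0 : ℝ)
    · have ht0' : 0 < t := ht0
      rw [Set.mem_Ioi, not_lt] at ht
      rw [Set.indicator_of_mem ht0, prof_eq_zero, mul_zero, ENNReal.ofReal_zero]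
      exact one_le_pow₀ (by rw [le_div_iff₀ ht0']; linarith)
    · rw [Set.indicator_of_notMem ht0]

lemma scaleConst_pos (n : ℕ) : scaleConst n ≠ 0 := by
  unfold scaleConst
  have hm : Measurable fun t : ℝ => ENNReal.ofReal (t ^ 3 * (t ^ n)⁻¹ * prof ((1 / t) ^ 2)) := by
    have := contDiff_prof.continuous.measurable
    fun_prop
  rw [Ne, lintegral_eq_zero_iff hm]
  intro h
  have h1 : ∀ᵐ t ∂(volume : Measure ℝ), t ∉ Set.Ioo (1 : ℝ) 2 := by
    rw [Filter.EventuallyEq, ae_restrict_iff' measurableSet_Ioi] at h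
    filter_upwards [h] with t ht ht'
    have h0 : 0 < t := one_pos.trans ht'.1
    have h2 := ht h0
    simp only [Pi.zero_apply, ENNReal.ofReal_eq_zero] at h2
    have h3 : 0 < prof ((1 / t) ^ 2) := prof_pos (by
      refine pow_lt_one₀ (by positivity) ?_ two_ne_zero
      rw [div_lt_one h0]; exact ht'.1)
    have : 0 < t ^ 3 * (t ^ n)⁻¹ * prof ((1 / t) ^ 2) := by positivity
    linarith
  have h2 : volume (Set.Ioo (1 : ℝ) 2) = 0 := by
    rw [ae_iff] at h1
    simpa only [not_not, Set.ofPred_mem_eq] using h1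
  norm_num at h2

variable {n : ℕ}

local notation "E" => EuclideanSpace ℝ (Fin n)

/-- The integral equation satisfied by entire bounded solutions. -/
lemma exists_integral_equation (hn : 5 ≤ n) {p : ℝ} (hp : 1 < p) {v : E → ℝ} {C : ℝ}
    (hvc : Continuous v) (hv0 : ∀ x, 0 ≤ v x)
    (h : ∀ (x : E) (R : ℝ), 0 < R →
      |(∫ y : E, rho y) * v x - ∫ t in (0 : ℝ)..R, t ^ 3 * ∫ y, v (x + t • y) ^ p * kap y| ≤
        C * R ^ (-(4 / (p - 1)))) :
    ∃ c : ℝ, 0 < c ∧ ∀ x, ENNReal.ofReal (v x) =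
      ENNReal.ofReal c * ∫⁻ z, ENNReal.ofReal (v z ^ p * (‖x - z‖ ^ (n - 4))⁻¹) := by
  have hp0 : 0 < p := by linarith
  have hc0 := integral_rho_pos hn
  have hvp : Continuous fun z => v z ^ p := hvc.rpow_const fun _ => Or.inr hp0.le
  have hkc := (contDiff_kap (n := n)).continuous
  have hpc := contDiff_prof.continuous
  have hG0 := scaleConst_pos n
  have hG1 := scaleConst_ne_top hn
  have hG : ENNReal.ofReal (scaleConst n).toReal = scaleConst n := ENNReal.ofReal_toReal hG1
  have hGp : 0 < (scaleConst n).toReal := ENNReal.toReal_pos hG0 hG1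
  refine ⟨(scaleConst n).toReal / ∫ y : E, rho y, div_pos hGp hc0, fun x => ?_⟩
  set F : ℝ → ℝ := fun t => t ^ 3 * ∫ y, v (x + t • y) ^ p * kap y with hF
  have hFc : Continuous F := by
    have := continuous_integral_comp_smul_mul hvp hkc (fun y => kap_eq_zero) x
    fun_prop
  have hF0 : ∀ t, 0 ≤ t → 0 ≤ F t := fun t ht => mul_nonneg (pow_nonneg ht 3)
    (integral_nonneg fun y => mul_nonneg (Real.rpow_nonneg (hv0 _) _) (kap_nonneg y))
  have hlim : Tendsto (fun R => ∫ t in (0 : ℝ)..R, F t) atTop (𝓝 ((∫ y : E, rho y) * v x)) := by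
    have h1 : Tendsto (fun R : ℝ => C * R ^ (-(4 / (p - 1)))) atTop (𝓝 0) := by
      have := (tendsto_rpow_neg_atTop (y := 4 / (p - 1))
        (div_pos (by norm_num) (by linarith))).const_mul C
      simpa using this
    rw [tendsto_iff_dist_tendsto_zero]
    refine squeeze_zero' (Eventually.of_forall fun _ => dist_nonneg) ?_ h1
    filter_upwards [eventually_gt_atTop 0] with R hR
    rw [dist_comm, Real.dist_eq]
    exact h x R hR
  have hintg : IntegrableOn F (Set.Ioi 0) := by
    refine integrableOn_Ioi_of_intervalIntegral_norm_tendsto _ 0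
      (fun i => hFc.integrableOn_Ioc) tendsto_id (hlim.congr' ?_)
    filter_upwards [eventually_ge_atTop 0] with R hR
    refine intervalIntegral.integral_congr fun t ht => ?_
    rw [Set.uIcc_of_le hR] at ht
    exact (Real.norm_of_nonneg (hF0 t ht.1)).symm
  have heq : ∫ t in Set.Ioi 0, F t = (∫ y : E, rho y) * v x :=
    tendsto_nhds_unique (intervalIntegral_tendsto_integral_Ioi 0 hintg tendsto_id) hlim
  have h1 : ENNReal.ofReal ((∫ y : E, rho y) * v x) = ∫⁻ t in Set.Ioi 0, ENNReal.ofReal (F t) := by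
    rw [← heq, ofReal_integral_eq_lintegral_ofReal hintg]
    exact (ae_restrict_iff' measurableSet_Ioi).2 (Eventually.of_forall fun t ht => hF0 t (le_of_lt ht))
  have h2 : ∀ t ∈ Set.Ioi (0 : ℝ), ENNReal.ofReal (F t) = ∫⁻ z,
      ENNReal.ofReal (t ^ 3 * (t ^ n)⁻¹ * (v z ^ p * prof ((‖x - z‖ / t) ^ 2))) := by
    intro t ht
    have ht' : 0 < t := ht
    rw [hF]
    simp only
    rw [ENNReal.ofReal_mul (by positivity), ofReal_integral_eq_lintegral_ofReal]
    · have e1 := lintegral_comp_add_smul_of_pos (volume : Measure E)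
        (fun z => ENNReal.ofReal (v z ^ p * prof ((‖x - z‖ / t) ^ 2))) x ht'
      have e2 : ∀ y : E, prof ((‖x - (x + t • y)‖ / t) ^ 2) = kap y := fun y => by
        rw [sub_add_cancel_left, norm_neg, norm_smul, Real.norm_of_nonneg ht'.le,
          mul_div_cancel_left₀ _ ht'.ne']
        rfl
      simp only [e2] at e1
      rw [e1, finrank_euclideanSpace_fin, ← mul_assoc, ← ENNReal.ofReal_mul (by positivity),
        ← lintegral_const_mul' _ _ ENNReal.ofReal_ne_top]
      refine lintegral_congr fun z => ?_
      rw [← ENNReal.ofReal_mul (by positivity)]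
    · refine Continuous.integrable_of_hasCompactSupport ?_ hasCompactSupport_kap.mul_left
      exact (hvp.comp (by fun_prop)).mul hkc
    · exact Eventually.of_forall fun y => mul_nonneg (Real.rpow_nonneg (hv0 _) _) (kap_nonneg y)
  have h3 : ∫⁻ t in Set.Ioi 0, ENNReal.ofReal (F t) = ∫⁻ z, ∫⁻ t in Set.Ioi (0 : ℝ),
      ENNReal.ofReal (t ^ 3 * (t ^ n)⁻¹ * (v z ^ p * prof ((‖x - z‖ / t) ^ 2))) := by
    rw [setLIntegral_congr_fun measurableSet_Ioi h2, lintegral_lintegral_swap]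
    refine Measurable.aemeasurable ?_
    have := hpc.measurable
    have := hvp.measurable
    fun_prop
  have h4 : ∫⁻ z, ∫⁻ t in Set.Ioi (0 : ℝ),
      ENNReal.ofReal (t ^ 3 * (t ^ n)⁻¹ * (v z ^ p * prof ((‖x - z‖ / t) ^ 2))) =
      scaleConst n * ∫⁻ z, ENNReal.ofReal (v z ^ p * (‖x - z‖ ^ (n - 4))⁻¹) := by
    rw [← lintegral_const_mul' _ _ hG1]
    have : Nontrivial E := by
      have : Nonempty (Fin n) := ⟨⟨0, by omega⟩⟩
      infer_instance
    have hne : ∀ᵐ z ∂(volume : Measure E), z ≠ x := by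
      simp [ae_iff]
    refine lintegral_congr_ae ?_
    filter_upwards [hne] with z hz
    have e1 : ∀ t : ℝ, ENNReal.ofReal (t ^ 3 * (t ^ n)⁻¹ * (v z ^ p * prof ((‖x - z‖ / t) ^ 2))) =
        ENNReal.ofReal (v z ^ p) *
          ENNReal.ofReal (t ^ 3 * (t ^ n)⁻¹ * prof ((‖x - z‖ / t) ^ 2)) := fun t => by
      rw [← ENNReal.ofReal_mul (Real.rpow_nonneg (hv0 z) _)]
      congr 1; ring
    simp only [e1]
    rw [lintegral_const_mul' _ _ ENNReal.ofReal_ne_top,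
      lintegral_scale (by omega) (norm_pos_iff.2 (sub_ne_zero.2 hz.symm)), ← mul_assoc,
      ← ENNReal.ofReal_mul (Real.rpow_nonneg (hv0 z) _), mul_comm]
  rw [h3, h4, ENNReal.ofReal_mul hc0.le] at h1
  have h5 : ENNReal.ofReal (v x) = ENNReal.ofReal (∫ y : E, rho y)⁻¹ *
      (ENNReal.ofReal (∫ y : E, rho y) * ENNReal.ofReal (v x)) := by
    rw [← mul_assoc, ← ENNReal.ofReal_mul (by positivity), inv_mul_cancel₀ hc0.ne',
      ENNReal.ofReal_one, one_mul]
  rw [h5, h1, ← mul_assoc, div_eq_inv_mul, ENNReal.ofReal_mul (by positivity), hG]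

end IntegralEquation

section Kelvin

variable {n : ℕ}

local notation "E" => EuclideanSpace ℝ (Fin n)

/-- Inversion in the sphere of radius `l` about the origin. -/
noncomputable def kinv (l : ℝ) (x : E) : E := (l / ‖x‖) ^ 2 • x

lemma kinv_eq (l : ℝ) : (kinv l : E → E) = EuclideanGeometry.inversion 0 l := by
  funext x
  simp [kinv, EuclideanGeometry.inversion]

lemma norm_kinv {l : ℝ} {x : E} : ‖kinv l x‖ = l ^ 2 / ‖x‖ := by
  have := EuclideanGeometry.dist_inversion_center (0 : E) x l
  rwa [← kinv_eq, dist_zero_right, dist_zero_right] at this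

lemma kinv_kinv {l : ℝ} (hl : l ≠ 0) (x : E) : kinv l (kinv l x) = x := by
  rw [kinv_eq, EuclideanGeometry.inversion_inversion _ hl]

lemma kinv_ne_zero {l : ℝ} (hl : l ≠ 0) {x : E} (hx : x ≠ 0) : kinv l x ≠ 0 := by
  rw [kinv_eq, Ne, EuclideanGeometry.inversion_eq_center hl]
  exact hx

lemma norm_sub_kinv {l : ℝ} (hl : 0 < l) {x z : E} (hx : x ≠ 0) (hz : z ≠ 0) :
    ‖x - kinv l z‖ = l / ‖z‖ * (‖x‖ / l * ‖kinv l x - z‖) := by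
  have h := EuclideanGeometry.dist_inversion_inversion (c := (0 : E))
    (kinv_ne_zero hl.ne' hx) hz l
  rw [← kinv_eq, kinv_kinv hl.ne', dist_zero_right, dist_zero_right, norm_kinv, dist_eq_norm,
    dist_eq_norm] at h
  have hx' := norm_pos_iff.2 hx
  have hz' := norm_pos_iff.2 hz
  rw [h]
  field_simp

lemma norm_sub_lt_kinv {l : ℝ} (hl : 0 < l) {x z : E} (hx : x ≠ 0) (hxl : ‖x‖ < l)
    (hzl : ‖z‖ < l) : ‖x - z‖ < ‖x‖ / l * ‖kinv l x - z‖ := by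
  have hx' := norm_pos_iff.2 hx
  refine lt_of_pow_lt_pow_left₀ 2 (by positivity) ?_
  rw [mul_pow, norm_sub_sq_real, norm_sub_sq_real, norm_kinv, kinv, real_inner_smul_left]
  have e : (‖x‖ / l) ^ 2 * ((l ^ 2 / ‖x‖) ^ 2 - 2 * ((l / ‖x‖) ^ 2 * inner ℝ x z) + ‖z‖ ^ 2) -
      (‖x‖ ^ 2 - 2 * inner ℝ x z + ‖z‖ ^ 2) =
      (l ^ 2 - ‖x‖ ^ 2) * (l ^ 2 - ‖z‖ ^ 2) / l ^ 2 := by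
    field_simp
    ring
  have h1 : 0 < l ^ 2 - ‖x‖ ^ 2 := by nlinarith
  have h2 : 0 < l ^ 2 - ‖z‖ ^ 2 := by nlinarith [norm_nonneg z]
  have : 0 < (l ^ 2 - ‖x‖ ^ 2) * (l ^ 2 - ‖z‖ ^ 2) / l ^ 2 := by positivity
  linarith

lemma abs_det_fderiv_kinv {l : ℝ} (x : E) :
    |((l / dist x 0) ^ 2 • ((ℝ ∙ (x - 0))ᗮ.reflection : E →L[ℝ] E)).det| =
      (l / ‖x‖) ^ (2 * n) := by
  have h1 : ((l / dist x 0) ^ 2 • ((ℝ ∙ (x - 0))ᗮ.reflection : E →L[ℝ] E)).det =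
      LinearMap.det ((l / dist x 0) ^ 2 • ((ℝ ∙ (x - 0))ᗮ.reflection.toLinearMap : E →ₗ[ℝ] E)) := rfl
  rw [h1, LinearMap.det_smul, Submodule.det_reflection, abs_mul, abs_pow, abs_pow, abs_pow, abs_neg,
    abs_one, one_pow, mul_one, finrank_euclideanSpace_fin, sq_abs, dist_zero_right, ← pow_mul]

/-- The punctured ball of radius `l`. -/
def pball (n : ℕ) (l : ℝ) : Set (EuclideanSpace ℝ (Fin n)) := ball 0 l \ {0}

lemma mem_pball {l : ℝ} {x : E} : x ∈ pball n l ↔ ‖x‖ < l ∧ x ≠ 0 := by simp [pball]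

lemma measurableSet_pball (l : ℝ) : MeasurableSet (pball n l) :=
  measurableSet_ball.diff (measurableSet_singleton _)

lemma kinv_image_pball {l : ℝ} (hl : 0 < l) : kinv l '' pball n l = (closedBall (0 : E) l)ᶜ := by
  ext y
  simp only [Set.mem_image, mem_pball, Set.mem_compl_iff, mem_closedBall_zero_iff, not_le]
  constructor
  · rintro ⟨x, ⟨hx, hx0⟩, rfl⟩
    have hx' := norm_pos_iff.2 hx0
    rw [norm_kinv, lt_div_iff₀ hx']
    nlinarith
  · intro hy
    have hy0 : 0 < ‖y‖ := hl.trans hy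
    refine ⟨kinv l y, ⟨?_, kinv_ne_zero hl.ne' (norm_pos_iff.1 hy0)⟩, kinv_kinv hl.ne' y⟩
    rw [norm_kinv, div_lt_iff₀ hy0]
    nlinarith

lemma hasFDerivWithinAt_kinv (l : ℝ) : ∀ x ∈ pball n l, HasFDerivWithinAt (kinv l)
    ((l / dist x 0) ^ 2 • ((ℝ ∙ (x - 0))ᗮ.reflection : E →L[ℝ] E)) (pball n l) x := by
  intro x hx
  rw [kinv_eq]
  exact (EuclideanGeometry.hasFDerivAt_inversion (mem_pball.1 hx).2).hasFDerivWithinAt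

lemma injOn_kinv {l : ℝ} (hl : l ≠ 0) (s : Set E) : s.InjOn (kinv l) :=
  (Function.LeftInverse.injective (kinv_kinv hl)).injOn

lemma integrableOn_kinv {l : ℝ} (hl : 0 < l) {f : E → ℝ} (hf : Integrable f) :
    IntegrableOn (fun z => (l / ‖z‖) ^ (2 * n) * f (kinv l z)) (pball n l) := by
  have h := (integrableOn_image_iff_integrableOn_abs_det_fderiv_smul volume
    (measurableSet_pball l) (hasFDerivWithinAt_kinv l) (injOn_kinv hl.ne' _) f).1 hf.integrableOn
  simpa only [abs_det_fderiv_kinv, smul_eq_mul] using h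

lemma pball_ae_eq [Nontrivial E] (l : ℝ) :
    pball n l =ᵐ[volume] closedBall (0 : E) l := by
  have h1 : pball n l =ᵐ[volume] ball (0 : E) l := sdiff_null_ae_eq_self (by simp)
  refine h1.trans ?_
  have : (closedBall (0 : E) l) = ball 0 l ∪ sphere 0 l := ball_union_sphere.symm
  rw [this]
  exact (union_ae_eq_left_of_ae_eq_empty (ae_eq_empty.2 (Measure.addHaar_sphere _ _ _))).symm

lemma integral_eq_add_kinv [Nontrivial E] {l : ℝ} (hl : 0 < l) {f : E → ℝ} (hf : Integrable f) :
    ∫ z, f z = (∫ z in pball n l, f z) +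
      ∫ z in pball n l, (l / ‖z‖) ^ (2 * n) * f (kinv l z) := by
  have h := integral_image_eq_integral_abs_det_fderiv_smul volume
    (measurableSet_pball l) (hasFDerivWithinAt_kinv l) (injOn_kinv hl.ne' _) f
  simp only [abs_det_fderiv_kinv, smul_eq_mul] at h
  rw [← h, kinv_image_pball hl, setIntegral_congr_set (pball_ae_eq l),
    integral_add_compl measurableSet_closedBall hf]

/-- The Kelvin transform of `v` in the sphere of radius `l` about the origin. -/
noncomputable def kelvin (l : ℝ) (v : E → ℝ) (x : E) : ℝ := (l / ‖x‖) ^ (n - 4) * v (kinv l x)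

/-- The density produced by inverting the integral equation. -/
noncomputable def kdens (l p : ℝ) (v : E → ℝ) (z : E) : ℝ :=
  (l / ‖z‖) ^ (2 * n) * v (kinv l z) ^ p * (‖z‖ / l) ^ (n - 4)

/-- The reflected kernel. -/
noncomputable def kker (l : ℝ) (x z : E) : ℝ := ((‖x‖ / l * ‖kinv l x - z‖) ^ (n - 4))⁻¹

/-- Bounded positive solutions of the integral equation. -/
structure IsIntegralSol (p M c : ℝ) (v : EuclideanSpace ℝ (Fin n) → ℝ) : Prop where
  continuous : Continuous v
  pos : ∀ x, 0 < v x
  le : ∀ x, v x ≤ M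
  integrable : ∀ x, Integrable fun z => v z ^ p * (‖x - z‖ ^ (n - 4))⁻¹
  eq : ∀ x, v x = c * ∫ z, v z ^ p * (‖x - z‖ ^ (n - 4))⁻¹

variable {p M c l : ℝ} {v : EuclideanSpace ℝ (Fin n) → ℝ}

lemma kdens_mul_kker (hl : 0 < l) {x z : E} (hx : x ≠ 0) (hz : z ≠ 0) :
    (l / ‖z‖) ^ (2 * n) * (v (kinv l z) ^ p * (‖x - kinv l z‖ ^ (n - 4))⁻¹) =
      kdens l p v z * kker l x z := by
  have hz' := norm_pos_iff.2 hz
  rw [norm_sub_kinv hl hx hz, kdens, kker, mul_pow (l / ‖z‖), mul_inv, ← inv_pow (l / ‖z‖), inv_div]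
  ring

lemma IsIntegralSol.split [Nontrivial E] (hv : IsIntegralSol p M c v) (hl : 0 < l) {x : E}
    (hx : x ≠ 0) :
    IntegrableOn (fun z : E => v z ^ p * (‖x - z‖ ^ (n - 4))⁻¹) (pball n l) ∧
    IntegrableOn (fun z : E => kdens l p v z * kker l x z) (pball n l) ∧
    v x = c * ((∫ z : E in pball n l, v z ^ p * (‖x - z‖ ^ (n - 4))⁻¹) +
      ∫ z : E in pball n l, kdens l p v z * kker l x z) := by
  have h1 := integrableOn_kinv hl (hv.integrable x)
  have e : ∀ z : E, z ∈ pball n l → (l / ‖z‖) ^ (2 * n) *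
      (v (kinv l z) ^ p * (‖x - kinv l z‖ ^ (n - 4))⁻¹) = kdens l p v z * kker l x z :=
    fun z hz => kdens_mul_kker hl hx (mem_pball.1 hz).2
  refine ⟨(hv.integrable x).integrableOn, h1.congr_fun e (measurableSet_pball l), ?_⟩
  rw [hv.eq x, integral_eq_add_kinv hl (hv.integrable x),
    setIntegral_congr_fun (measurableSet_pball l) e]

lemma kker_kinv (hl : 0 < l) {x : E} (hx : x ≠ 0) (z : E) :
    (l / ‖x‖) ^ (n - 4) * kker l (kinv l x) z = (‖x - z‖ ^ (n - 4))⁻¹ := by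
  have hx' := norm_pos_iff.2 hx
  rw [kker, kinv_kinv hl.ne', norm_kinv, mul_pow, mul_inv, ← mul_assoc]
  have : l ^ 2 / ‖x‖ / l = l / ‖x‖ := by field_simp
  rw [this, mul_inv_cancel₀ (by positivity), one_mul]

lemma kker_eq (x z : E) :
    kker l x z = (l / ‖x‖) ^ (n - 4) * (‖kinv l x - z‖ ^ (n - 4))⁻¹ := by
  rw [kker, mul_pow, mul_inv, ← inv_pow, inv_div]

/-- The difference of a solution and its Kelvin transform. -/
lemma IsIntegralSol.sub_kelvin [Nontrivial E] (hv : IsIntegralSol p M c v) (hl : 0 < l) {x : E}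
    (hx : x ≠ 0) :
    IntegrableOn (fun z : E => (v z ^ p - kdens l p v z) * ((‖x - z‖ ^ (n - 4))⁻¹ - kker l x z))
      (pball n l) ∧
    v x - kelvin l v x = c * ∫ z : E in pball n l,
      (v z ^ p - kdens l p v z) * ((‖x - z‖ ^ (n - 4))⁻¹ - kker l x z) := by
  obtain ⟨i1, i2, e1⟩ := hv.split hl hx
  obtain ⟨i3, i4, e2⟩ := hv.split hl (kinv_ne_zero hl.ne' hx)
  have i3' : IntegrableOn (fun z : E => v z ^ p * kker l x z) (pball n l) := by
    refine (i3.const_mul ((l / ‖x‖) ^ (n - 4))).congr (Eventually.of_forall fun z => ?_)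
    simp only
    rw [kker_eq]; ring
  have i4' : IntegrableOn (fun z : E => kdens l p v z * (‖x - z‖ ^ (n - 4))⁻¹) (pball n l) := by
    refine (i4.const_mul ((l / ‖x‖) ^ (n - 4))).congr (Eventually.of_forall fun z => ?_)
    simp only
    rw [← kker_kinv hl hx]; ring
  have e3 : kelvin l v x = c * ((∫ z : E in pball n l, v z ^ p * kker l x z) +
      ∫ z : E in pball n l, kdens l p v z * (‖x - z‖ ^ (n - 4))⁻¹) := by
    rw [kelvin, e2, mul_left_comm, mul_add, ← integral_const_mul, ← integral_const_mul]
    congr 2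
    · refine integral_congr_ae (Eventually.of_forall fun z => ?_)
      simp only
      rw [kker_eq]; ring
    · refine integral_congr_ae (Eventually.of_forall fun z => ?_)
      simp only
      rw [← kker_kinv hl hx]; ring
  have e4 : ∀ z : E, (v z ^ p - kdens l p v z) * ((‖x - z‖ ^ (n - 4))⁻¹ - kker l x z) =
      (v z ^ p * (‖x - z‖ ^ (n - 4))⁻¹ + kdens l p v z * kker l x z) -
      (v z ^ p * kker l x z + kdens l p v z * (‖x - z‖ ^ (n - 4))⁻¹) := fun z => by ring
  simp only [e4]
  refine ⟨(i1.add i2).sub (i3'.add i4'), ?_⟩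
  have e5 := integral_sub (i1.add i2) (i3'.add i4')
  have e6 := integral_add i1 i2
  have e7 := integral_add i3' i4'
  simp only [Pi.add_apply] at e5
  rw [e5, e6, e7, e1, e3]
  ring

lemma kelvin_pos (hv : ∀ x, 0 < v x) (hl : 0 < l) {x : E} (hx : x ≠ 0) : 0 < kelvin l v x := by
  have hx' := norm_pos_iff.2 hx
  exact mul_pos (by positivity) (hv _)

lemma kelvin_rpow_lt_kdens (hn : 5 ≤ n) (hp2 : p < ((n : ℝ) + 4) / ((n : ℝ) - 4))
    (hv : ∀ x, 0 < v x) {z : E} (hz : z ∈ pball n l) : kelvin l v z ^ p < kdens l p v z := by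
  obtain ⟨hzl, hz0⟩ := mem_pball.1 hz
  have hz' := norm_pos_iff.2 hz0
  have hl : 0 < l := hz'.trans hzl
  have hq : 1 < l / ‖z‖ := (one_lt_div hz').2 hzl
  have hvz := hv (kinv l z)
  have hn' : (5 : ℝ) ≤ n := by exact_mod_cast hn
  rw [lt_div_iff₀ (by linarith)] at hp2
  have hcast : ((n - 4 : ℕ) : ℝ) = (n : ℝ) - 4 := by
    rw [Nat.cast_sub (by omega)]; norm_num
  rw [kelvin, kdens, ← inv_div l ‖z‖]
  set q := l / ‖z‖ with hqdef
  have hq0 : 0 < q := by linarith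
  rw [Real.mul_rpow (by positivity) hvz.le, mul_right_comm]
  refine mul_lt_mul_of_pos_right ?_ (by positivity)
  have h1 : q ^ (2 * n) * q⁻¹ ^ (n - 4) = q ^ ((n : ℝ) + 4) := by
    rw [inv_pow, ← Real.rpow_natCast q (2 * n), ← Real.rpow_natCast q (n - 4),
      ← Real.rpow_neg hq0.le, ← Real.rpow_add hq0, hcast]
    congr 1
    push_cast
    ring
  rw [h1, ← Real.rpow_natCast, ← Real.rpow_mul hq0.le, hcast]
  refine Real.rpow_lt_rpow_of_exponent_lt hq ?_
  linarith

lemma kker_nonneg (hl : 0 < l) (x z : E) : 0 ≤ kker l x z := by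
  unfold kker; positivity

lemma kker_lt (hn : 5 ≤ n) {x z : E} (hx : x ∈ pball n l) (hz : z ∈ pball n l) (hxz : z ≠ x) :
    kker l x z < (‖x - z‖ ^ (n - 4))⁻¹ := by
  obtain ⟨hxl, hx0⟩ := mem_pball.1 hx
  have hl : 0 < l := (norm_pos_iff.2 hx0).trans hxl
  have h := norm_sub_lt_kinv hl hx0 hxl (mem_pball.1 hz).1
  have h0 : 0 < ‖x - z‖ := norm_pos_iff.2 (sub_ne_zero.2 hxz.symm)
  exact inv_strictAnti₀ (by positivity) (pow_lt_pow_left₀ h h0.le (by omega))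

end Kelvin

section MovingSpheres

variable {n : ℕ}

local notation "E" => EuclideanSpace ℝ (Fin n)

lemma nontrivial_euclidean (hn : 5 ≤ n) : Nontrivial (EuclideanSpace ℝ (Fin n)) := by
  apply Module.nontrivial_of_finrank_pos (R := ℝ)
  rw [finrank_euclideanSpace_fin]; omega

lemma setLIntegral_comp_sub_left (f : E → ENNReal) (x : E) (s : Set E) :
    ∫⁻ z in s, f (x - z) = ∫⁻ w in (fun w => x - w) ⁻¹' s, f w := by
  have h := (Measure.measurePreserving_sub_left (volume : Measure E) x).setLIntegral_comp_preimage_emb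
    (measurableEmbedding_subLeft x) f ((fun w => x - w) ⁻¹' s)
  rw [← h, ← Set.preimage_comp]
  congr
  ext z
  simp

lemma volume_preimage_sub_left (x : E) (s : Set E) :
    volume ((fun w => x - w) ⁻¹' s) = volume s :=
  (Measure.measurePreserving_sub_left (volume : Measure E) x).measure_preimage_emb
    (measurableEmbedding_subLeft x) s

lemma exists_setIntegral_kernel_le (hn : 5 ≤ n) {ε : ℝ} (hε : 0 < ε) :
    ∃ δ : ENNReal, 0 < δ ∧ ∀ N : Set E, volume N < δ → ∀ x : E,
      IntegrableOn (fun z => (‖x - z‖ ^ (n - 4))⁻¹) N ∧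
      ∫ z in N, (‖x - z‖ ^ (n - 4))⁻¹ ≤ ε := by
  have hmeas : Measurable fun z : E => (‖z‖ ^ (n - 4))⁻¹ := by fun_prop
  have hI : IntegrableOn (fun z : E => (‖z‖ ^ (n - 4))⁻¹) (ball 0 1) := by
    refine integrableOn_ball_of_norm_le_rpow (C := 1) (α := ((n - 4 : ℕ) : ℝ)) ?_ ?_ ?_
      hmeas.aestronglyMeasurable
    · rw [finrank_euclideanSpace_fin]; omega
    · rw [finrank_euclideanSpace_fin]; exact_mod_cast (by omega : n - 4 < n)
    · refine Eventually.of_forall fun z => ?_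
      rw [Real.rpow_neg (norm_nonneg _), Real.rpow_natCast, one_mul, Real.norm_of_nonneg]
      positivity
  set G : E → ENNReal := (ball (0 : E) 1).indicator fun z => ENNReal.ofReal (‖z‖ ^ (n - 4))⁻¹
    with hG
  have hGfin : ∫⁻ z, G z ≠ ⊤ := by
    rw [hG, lintegral_indicator measurableSet_ball]
    exact ((hasFiniteIntegral_iff_ofReal (Eventually.of_forall fun z => by positivity)).1 hI.2).ne
  obtain ⟨δ, hδ, hs⟩ := exists_pos_setLIntegral_lt_of_measure_lt hGfin
    (ε := ENNReal.ofReal (ε / 2)) (by simpa using hε)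
  refine ⟨min δ (ENNReal.ofReal (ε / 2)), lt_min hδ (by simpa using hε), fun N hN x => ?_⟩
  have hb : ∀ z : E, ENNReal.ofReal (‖x - z‖ ^ (n - 4))⁻¹ ≤ G (x - z) + 1 := by
    intro z
    by_cases hz : x - z ∈ ball (0 : E) 1
    · rw [hG, Set.indicator_of_mem hz]; exact le_self_add
    · refine le_trans ?_ le_add_self
      rw [ENNReal.ofReal_le_one]
      rw [mem_ball_zero_iff, not_lt] at hz
      exact inv_le_one_of_one_le₀ (one_le_pow₀ hz)
  have hl : ∫⁻ z in N, ENNReal.ofReal (‖x - z‖ ^ (n - 4))⁻¹ ≤ ENNReal.ofReal ε := by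
    calc ∫⁻ z in N, ENNReal.ofReal (‖x - z‖ ^ (n - 4))⁻¹
        ≤ ∫⁻ z in N, (G (x - z) + 1) := lintegral_mono fun z => hb z
      _ = (∫⁻ z in N, G (x - z)) + volume N := by
          rw [lintegral_add_right _ measurable_const]; simp
      _ ≤ ENNReal.ofReal (ε / 2) + ENNReal.ofReal (ε / 2) := by
          refine add_le_add ?_ (hN.le.trans (min_le_right _ _))
          rw [setLIntegral_comp_sub_left]
          refine (hs _ ?_).le
          rw [volume_preimage_sub_left]
          exact hN.trans_le (min_le_left _ _)
      _ = ENNReal.ofReal ε := by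
          rw [← ENNReal.ofReal_add (by positivity) (by positivity), add_halves]
  have hm : AEStronglyMeasurable (fun z => (‖x - z‖ ^ (n - 4))⁻¹) (volume.restrict N) := by
    have : Measurable fun z : E => (‖x - z‖ ^ (n - 4))⁻¹ := by fun_prop
    exact this.aestronglyMeasurable
  refine ⟨⟨hm, (hasFiniteIntegral_iff_ofReal (Eventually.of_forall fun z => by positivity)).2
    (hl.trans_lt ENNReal.ofReal_lt_top)⟩, ?_⟩
  rw [integral_eq_lintegral_of_nonneg_ae (Eventually.of_forall fun z => by positivity) hm]
  exact ENNReal.toReal_le_of_le_ofReal hε.le hl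

lemma rpow_sub_rpow_le {p k v : ℝ} (hp : 1 ≤ p) (hk : 0 ≤ k) (hv : 0 < v) :
    v ^ p - k ^ p ≤ p * v ^ (p - 1) * (v - k) := by
  have h := one_add_mul_self_le_rpow_one_add (s := k / v - 1) (by
    have : 0 ≤ k / v := by positivity
    linarith) hp
  rw [add_sub_cancel, Real.div_rpow hk hv.le, le_div_iff₀ (by positivity)] at h
  have e : v ^ p = v ^ (p - 1) * v := by
    rw [Real.rpow_sub_one hv.ne']; field_simp
  have e2 : (1 + p * (k / v - 1)) * v ^ p = v ^ p + p * v ^ (p - 1) * (k - v) := by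
    rw [e]; field_simp
  linarith

variable {p M c l : ℝ} {v : EuclideanSpace ℝ (Fin n) → ℝ}

lemma measurable_kelvin (hv : Continuous v) (l : ℝ) : Measurable (kelvin l v) := by
  have h1 : Measurable (kinv l : EuclideanSpace ℝ (Fin n) → _) := by
    unfold kinv
    fun_prop
  unfold kelvin
  exact ((measurable_const.div measurable_norm).pow_const _).mul (hv.measurable.comp h1)

/-- The set where the solution exceeds its Kelvin transform. -/
def badSet (v : EuclideanSpace ℝ (Fin n) → ℝ) (l : ℝ) : Set (EuclideanSpace ℝ (Fin n)) :=
  {z | z ∈ pball n l ∧ kelvin l v z < v z}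

lemma measurableSet_badSet (hv : Continuous v) (l : ℝ) : MeasurableSet (badSet v l) :=
  (measurableSet_pball l).inter (measurableSet_lt (measurable_kelvin hv l) hv.measurable)

lemma IsIntegralSol.le_kelvin_of_volume_lt (hn : 5 ≤ n) (hp : 1 < p)
    (hp2 : p < ((n : ℝ) + 4) / ((n : ℝ) - 4)) (hc : 0 < c) (hv : IsIntegralSol p M c v) :
    ∃ δ : ENNReal, 0 < δ ∧ ∀ l : ℝ, volume (badSet v l) < δ →
      ∀ x ∈ pball n l, v x ≤ kelvin l v x := by
  have := nontrivial_euclidean hn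
  have hM : 0 < M := (hv.pos 0).trans_le (hv.le 0)
  have hP : 0 < p * M ^ (p - 1) := by positivity
  obtain ⟨δ, hδ, hN⟩ := exists_setIntegral_kernel_le (n := n) hn
    (ε := 1 / (2 * (c * (p * M ^ (p - 1))))) (by positivity)
  refine ⟨δ, hδ, fun l hl => ?_⟩
  have hstep : ∀ D : ℝ, 0 ≤ D → (∀ x ∈ pball n l, v x - kelvin l v x ≤ D) →
      ∀ x ∈ pball n l, v x - kelvin l v x ≤ D / 2 := by
    intro D hD h x hx
    have hx' := mem_pball.1 hx
    have hl0 : 0 < l := (norm_pos_iff.2 hx'.2).trans hx'.1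
    obtain ⟨hintg, heq⟩ := hv.sub_kelvin hl0 hx'.2
    obtain ⟨hA, hAle⟩ := hN _ hl x
    have hA' : Integrable ((badSet v l).indicator fun z => (‖x - z‖ ^ (n - 4))⁻¹) :=
      (integrable_indicator_iff (measurableSet_badSet hv.continuous l)).2 hA
    have hle : ∫ z in pball n l, (v z ^ p - kdens l p v z) * ((‖x - z‖ ^ (n - 4))⁻¹ - kker l x z) ≤
        ∫ z in pball n l, p * M ^ (p - 1) * D *
          (badSet v l).indicator (fun z => (‖x - z‖ ^ (n - 4))⁻¹) z := by
      refine setIntegral_mono_on_ae hintg (hA'.const_mul _).integrableOn (measurableSet_pball l) ?_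
      have hne : ∀ᵐ z : E, z ≠ x := by
        rw [ae_iff]; simp
      filter_upwards [hne] with z hzx hz
      have hk := kker_lt hn hx hz hzx
      have hk0 := kker_nonneg hl0 x z
      have hd := kelvin_rpow_lt_kdens hn hp2 hv.pos hz
      have hkz := kelvin_pos hv.pos hl0 (mem_pball.1 hz).2
      by_cases hzN : z ∈ badSet v l
      · rw [Set.indicator_of_mem hzN]
        have h1 := rpow_sub_rpow_le hp.le hkz.le (hv.pos z)
        have h2 : v z ^ (p - 1) ≤ M ^ (p - 1) :=
          Real.rpow_le_rpow (hv.pos z).le (hv.le z) (by linarith)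
        have h3 : p * v z ^ (p - 1) * (v z - kelvin l v z) ≤ p * M ^ (p - 1) * D := by
          have := h z hz
          have := hzN.2
          have h0 := Real.rpow_nonneg (hv.pos z).le (p - 1)
          gcongr
        calc (v z ^ p - kdens l p v z) * ((‖x - z‖ ^ (n - 4))⁻¹ - kker l x z)
            ≤ (p * M ^ (p - 1) * D) * ((‖x - z‖ ^ (n - 4))⁻¹ - kker l x z) := by
              gcongr
              · linarith
          _ ≤ _ := by
              gcongr
              linarith
      · rw [Set.indicator_of_notMem hzN, mul_zero]
        have h1 : v z ≤ kelvin l v z := by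
          by_contra hlt
          exact hzN ⟨hz, not_le.1 hlt⟩
        have h2 := Real.rpow_le_rpow (hv.pos z).le h1 (by linarith : 0 ≤ p)
        exact mul_nonpos_of_nonpos_of_nonneg (by linarith) (by linarith)
    have hle2 : ∫ z in pball n l, p * M ^ (p - 1) * D *
          (badSet v l).indicator (fun z => (‖x - z‖ ^ (n - 4))⁻¹) z ≤
        p * M ^ (p - 1) * D * (1 / (2 * (c * (p * M ^ (p - 1))))) := by
      rw [integral_const_mul]
      gcongr
      refine le_trans (setIntegral_le_integral hA' (Eventually.of_forall fun z =>
        Set.indicator_nonneg (fun z _ => by positivity) z)) ?_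
      rwa [integral_indicator (measurableSet_badSet hv.continuous l)]
    rw [heq]
    calc _ ≤ c * (p * M ^ (p - 1) * D * (1 / (2 * (c * (p * M ^ (p - 1)))))) := by
          gcongr
          exact hle.trans hle2
      _ = D / 2 := by field_simp
  have hall : ∀ k : ℕ, ∀ x ∈ pball n l, v x - kelvin l v x ≤ M / 2 ^ k := by
    intro k
    induction k with
    | zero =>
      intro x hx
      have hx' := mem_pball.1 hx
      have := kelvin_pos hv.pos ((norm_pos_iff.2 hx'.2).trans hx'.1) hx'.2
      have := hv.le x
      simp only [pow_zero, div_one]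
      linarith
    | succ k ih =>
      have := hstep _ (by positivity) ih
      intro x hx
      refine (this x hx).trans_eq ?_
      rw [pow_succ]; field_simp
  intro x hx
  have hlim : Tendsto (fun k : ℕ => M / 2 ^ k) atTop (𝓝 0) :=
    tendsto_const_nhds.div_atTop (tendsto_pow_atTop_atTop_of_one_lt one_lt_two)
  have := ge_of_tendsto' hlim fun k => hall k x hx
  linarith

lemma tendsto_kelvin (hv : Continuous v) (l : ℝ) {x : E} (hx : x ≠ 0) :
    Tendsto (fun m => kelvin m v x) (𝓝 l) (𝓝 (kelvin l v x)) := by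
  have hx' : ‖x‖ ≠ 0 := norm_ne_zero_iff.2 hx
  have : Continuous fun m => kelvin m v x := by
    unfold kelvin kinv
    fun_prop
  exact this.tendsto l

lemma IsIntegralSol.lt_kelvin (hn : 5 ≤ n) (hp : 1 < p)
    (hp2 : p < ((n : ℝ) + 4) / ((n : ℝ) - 4)) (hc : 0 < c) (hv : IsIntegralSol p M c v)
    (h : ∀ x ∈ pball n l, v x ≤ kelvin l v x) {x : E} (hx : x ∈ pball n l) :
    v x < kelvin l v x := by
  have := nontrivial_euclidean hn
  have hx' := mem_pball.1 hx
  have hl0 : 0 < l := (norm_pos_iff.2 hx'.2).trans hx'.1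
  obtain ⟨hintg, heq⟩ := hv.sub_kelvin hl0 hx'.2
  have hneg : ∀ z ∈ pball n l, z ≠ x →
      (v z ^ p - kdens l p v z) * ((‖x - z‖ ^ (n - 4))⁻¹ - kker l x z) < 0 := by
    intro z hz hzx
    have hk := kker_lt hn hx hz hzx
    have hd := kelvin_rpow_lt_kdens hn hp2 hv.pos hz
    have h2 := Real.rpow_le_rpow (hv.pos z).le (h z hz) (by linarith : 0 ≤ p)
    exact mul_neg_of_neg_of_pos (by linarith) (by linarith)
  have hne : ∀ᵐ z : E, z ≠ x := by
    rw [ae_iff]; simp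
  have hpos : 0 < ∫ z in pball n l,
      -((v z ^ p - kdens l p v z) * ((‖x - z‖ ^ (n - 4))⁻¹ - kker l x z)) := by
    rw [setIntegral_pos_iff_support_of_nonneg_ae]
    · have hsub : ball (0 : E) l \ {0, x} ⊆ Function.support (fun z => -((v z ^ p - kdens l p v z) *
          ((‖x - z‖ ^ (n - 4))⁻¹ - kker l x z))) ∩ pball n l := by
        intro z hz
        simp only [Set.mem_sdiff, Set.mem_insert_iff, Set.mem_singleton_iff, not_or,
          mem_ball_zero_iff] at hz
        have hzp : z ∈ pball n l := mem_pball.2 ⟨hz.1, hz.2.1⟩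
        exact ⟨neg_ne_zero.2 (hneg z hzp hz.2.2).ne, hzp⟩
      refine lt_of_lt_of_le ?_ (measure_mono hsub)
      rw [measure_sdiff_null ((Set.toFinite _).measure_zero volume)]
      exact measure_ball_pos _ _ hl0
    · rw [EventuallyLE, ae_restrict_iff' (measurableSet_pball l)]
      filter_upwards [hne] with z hzx hz
      have := hneg z hz hzx
      simp only [Pi.zero_apply]
      linarith
    · exact hintg.neg
  rw [integral_neg] at hpos
  have := mul_pos hc hpos
  linarith

lemma IsIntegralSol.eventually_le_kelvin (hn : 5 ≤ n) (hp : 1 < p)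
    (hp2 : p < ((n : ℝ) + 4) / ((n : ℝ) - 4)) (hc : 0 < c) (hv : IsIntegralSol p M c v)
    (h : ∀ x ∈ pball n l, v x ≤ kelvin l v x) :
    ∀ᶠ m in 𝓝 l, ∀ x ∈ pball n m, v x ≤ kelvin m v x := by
  have := nontrivial_euclidean hn
  obtain ⟨δ, hδ, hS⟩ := hv.le_kelvin_of_volume_lt hn hp hp2 hc
  have hlim : Tendsto (fun m => volume (badSet v m)) (𝓝 l) (𝓝 (volume (∅ : Set E))) := by
    refine tendsto_measure_of_ae_tendsto_indicator (𝓝 l) MeasurableSet.empty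
      (fun m => measurableSet_badSet hv.continuous m) (B := ball 0 (l + 1)) measurableSet_ball
      measure_ball_lt_top.ne ?_ ?_
    · filter_upwards [eventually_lt_nhds (by linarith : l < l + 1)] with m hm z hz
      have := (mem_pball.1 hz.1).1
      rw [mem_ball_zero_iff]
      linarith
    · have hne : ∀ᵐ z : E, z ≠ 0 := by
        rw [ae_iff]; simp
      have hsph : ∀ᵐ z : E, z ∉ sphere (0 : E) l := by
        rw [ae_iff]
        simp only [not_not]
        exact Measure.addHaar_sphere volume (0 : E) l
      filter_upwards [hne, hsph] with z hz hzl
      rw [mem_sphere_zero_iff_norm] at hzl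
      rcases lt_or_gt_of_ne hzl with hlt | hgt
      · have h1 := hv.lt_kelvin hn hp hp2 hc h (mem_pball.2 ⟨hlt, hz⟩)
        filter_upwards [(tendsto_kelvin hv.continuous l hz).eventually_const_lt h1] with m hm
        simp only [Set.mem_empty_iff_false, iff_false]
        exact fun hb => absurd hb.2 (not_lt.2 hm.le)
      · filter_upwards [eventually_lt_nhds hgt] with m hm
        simp only [Set.mem_empty_iff_false, iff_false]
        exact fun hb => absurd (mem_pball.1 hb.1).1 (not_lt.2 hm.le)
  rw [measure_empty] at hlim
  filter_upwards [hlim.eventually_lt_const hδ] with m hm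
  exact hS m hm

lemma IsIntegralSol.exists_le_kelvin (hn : 5 ≤ n) (hp : 1 < p)
    (hp2 : p < ((n : ℝ) + 4) / ((n : ℝ) - 4)) (hc : 0 < c) (hv : IsIntegralSol p M c v) :
    ∃ l₀ > 0, ∀ l < l₀, ∀ x ∈ pball n l, v x ≤ kelvin l v x := by
  have := hv.eventually_le_kelvin (l := 0) hn hp hp2 hc (fun x hx => by
    have := (mem_pball.1 hx).1
    linarith [norm_nonneg x])
  obtain ⟨e, he, hb⟩ := Metric.eventually_nhds_iff.1 this
  refine ⟨e, he, fun l hl x hx => hb ?_ x hx⟩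
  have : 0 < l := (norm_nonneg x).trans_lt (mem_pball.1 hx).1
  rwa [Real.dist_eq, sub_zero, abs_of_pos this]

/-- The method of moving spheres: the solution is dominated by all its Kelvin transforms. -/
lemma IsIntegralSol.le_kelvin (hn : 5 ≤ n) (hp : 1 < p)
    (hp2 : p < ((n : ℝ) + 4) / ((n : ℝ) - 4)) (hc : 0 < c) (hv : IsIntegralSol p M c v) (l : ℝ) :
    ∀ x ∈ pball n l, v x ≤ kelvin l v x := by
  by_contra hcon
  obtain ⟨l₀, hl₀, hsmall⟩ := hv.exists_le_kelvin hn hp hp2 hc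
  set B : Set ℝ := {l | ¬ ∀ x ∈ pball n l, v x ≤ kelvin l v x} with hB
  have hne : B.Nonempty := ⟨l, hcon⟩
  have hbdd : BddBelow B := ⟨l₀, fun m hm => not_lt.1 fun hlt => hm (hsmall m hlt)⟩
  have hbelow : ∀ m < sInf B, ∀ x ∈ pball n m, v x ≤ kelvin m v x := by
    intro m hm
    by_contra hmB
    exact absurd (csInf_le hbdd (show m ∈ B from hmB)) (not_le.2 hm)
  have hL : ∀ x ∈ pball n (sInf B), v x ≤ kelvin (sInf B) v x := by
    intro x hx
    obtain ⟨hx1, hx0⟩ := mem_pball.1 hx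
    have ht : Tendsto (fun m => kelvin m v x) (𝓝[<] (sInf B)) (𝓝 (kelvin (sInf B) v x)) :=
      (tendsto_kelvin hv.continuous _ hx0).mono_left nhdsWithin_le_nhds
    refine ge_of_tendsto ht ?_
    filter_upwards [self_mem_nhdsWithin, nhdsWithin_le_nhds (eventually_gt_nhds hx1)] with m hm hm2
    exact hbelow m hm x (mem_pball.2 ⟨hm2, hx0⟩)
  obtain ⟨e, he, hb⟩ := Metric.eventually_nhds_iff.1
    (hv.eventually_le_kelvin hn hp hp2 hc hL)
  obtain ⟨b, hbB, hlt⟩ := exists_lt_of_csInf_lt hne (by linarith : sInf B < sInf B + e)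
  refine hbB (hb ?_)
  have := csInf_le hbdd hbB
  rw [Real.dist_eq, abs_of_nonneg (by linarith)]
  linarith

lemma IsIntegralSol.comp_add (hv : IsIntegralSol p M c v) (b : E) :
    IsIntegralSol p M c fun x => v (b + x) := by
  have e : ∀ x z : E, v (b + z) ^ p * (‖x - z‖ ^ (n - 4))⁻¹ =
      (fun w => v w ^ p * (‖(b + x) - w‖ ^ (n - 4))⁻¹) (b + z) := by
    intro x z
    simp
  refine ⟨by have := hv.continuous; fun_prop, fun x => hv.pos _, fun x => hv.le _,
    fun x => ?_, fun x => ?_⟩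
  · simp only [e]
    exact (hv.integrable (b + x)).comp_add_left b
  · simp only [e]
    rw [integral_add_left_eq_self (fun w => v w ^ p * (‖(b + x) - w‖ ^ (n - 4))⁻¹) b]
    exact hv.eq _

lemma IsIntegralSol.le_of_ne (hn : 5 ≤ n) (hp : 1 < p)
    (hp2 : p < ((n : ℝ) + 4) / ((n : ℝ) - 4)) (hc : 0 < c) (hv : IsIntegralSol p M c v)
    {y z : E} (hyz : y ≠ z) : v y ≤ v z := by
  have hzy : z - y ≠ 0 := sub_ne_zero.2 hyz.symm
  have key : ∀ s : ℝ, 1 < s → v y ≤ s ^ (n - 4) * v z := by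
    intro s hs
    have hs2 : 0 < s ^ 2 - 1 := by nlinarith
    set x : E := (1 / (s ^ 2 - 1)) • (z - y) with hx
    have hx0 : x ≠ 0 := smul_ne_zero (by positivity) hzy
    have hxn := norm_pos_iff.2 hx0
    have h := (hv.comp_add (y - x)).le_kelvin hn hp hp2 hc (s * ‖x‖) x
      (mem_pball.2 ⟨by nlinarith, hx0⟩)
    have e1 : s * ‖x‖ / ‖x‖ = s := by field_simp
    have e2 : y - x + s ^ 2 • x = z := by
      have : y - x + s ^ 2 • x = y + (s ^ 2 - 1) • x := by module
      rw [this, hx, smul_smul, mul_one_div_cancel hs2.ne', one_smul]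
      abel
    rw [kelvin, kinv, e1, e2, sub_add_cancel] at h
    exact h
  have hlim : Tendsto (fun s : ℝ => s ^ (n - 4) * v z) (𝓝[>] 1) (𝓝 (1 ^ (n - 4) * v z)) := by
    refine Tendsto.mono_left ?_ nhdsWithin_le_nhds
    have : Continuous fun s : ℝ => s ^ (n - 4) * v z := by fun_prop
    exact this.tendsto 1
  rw [one_pow, one_mul] at hlim
  refine ge_of_tendsto hlim ?_
  filter_upwards [self_mem_nhdsWithin] with s hs
  exact key s hs

/-- A Liouville theorem in the subcritical range. -/
theorem not_isIntegralSol (hn : 5 ≤ n) (hp : 1 < p)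
    (hp2 : p < ((n : ℝ) + 4) / ((n : ℝ) - 4)) (hc : 0 < c) : ¬ IsIntegralSol p M c v := by
  intro hv
  have hconst : ∀ y, v y = v 0 := by
    intro y
    by_cases hy : y = 0
    · rw [hy]
    · exact le_antisymm (hv.le_of_ne hn hp hp2 hc hy) (hv.le_of_ne hn hp hp2 hc (Ne.symm hy))
  have heq := hv.eq 0
  set f : E → ℝ := fun z => v z ^ p * (‖0 - z‖ ^ (n - 4))⁻¹ with hf
  have hscale := Measure.integral_comp_smul (volume : Measure E) f 2
  have e : ∀ z, f ((2 : ℝ) • z) = (2 ^ (n - 4))⁻¹ * f z := by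
    intro z
    simp only [hf, zero_sub, norm_neg, norm_smul, hconst ((2 : ℝ) • z), hconst z, mul_pow, mul_inv]
    norm_num
    ring
  simp only [e] at hscale
  rw [integral_const_mul, finrank_euclideanSpace_fin, abs_of_pos (by positivity), smul_eq_mul]
    at hscale
  have hlt : ((2 : ℝ) ^ n)⁻¹ < (2 ^ (n - 4))⁻¹ :=
    inv_strictAnti₀ (by positivity) (pow_lt_pow_right₀ one_lt_two (by omega))
  have h0 : ∫ z, f z = 0 := by
    by_contra hI
    exact hlt.ne' (mul_right_cancel₀ hI hscale)
  rw [h0, mul_zero] at heq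
  exact (hv.pos 0).ne' heq

end MovingSpheres

section Assembly

variable {n : ℕ}

local notation "E" => EuclideanSpace ℝ (Fin n)

lemma isIntegralSol_of_lintegral (hn : 5 ≤ n) {p M c : ℝ} (hp : 0 < p) (hc : 0 < c) {v : E → ℝ}
    (hvc : Continuous v) (hv0 : ∀ x, 0 ≤ v x) (hvM : ∀ x, v x ≤ M) (hv1 : v 0 = 1)
    (h : ∀ x, ENNReal.ofReal (v x) =
      ENNReal.ofReal c * ∫⁻ z, ENNReal.ofReal (v z ^ p * (‖x - z‖ ^ (n - 4))⁻¹)) :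
    IsIntegralSol p M c v := by
  have := nontrivial_euclidean hn
  have hvp : Continuous fun z => v z ^ p := hvc.rpow_const fun _ => Or.inr hp.le
  have hmeas : ∀ x : E, Measurable fun z => v z ^ p * (‖x - z‖ ^ (n - 4))⁻¹ := by
    intro x
    have h1 : Measurable fun z : E => (‖x - z‖ ^ (n - 4))⁻¹ := by fun_prop
    exact hvp.measurable.mul h1
  have hnn : ∀ x z : E, 0 ≤ v z ^ p * (‖x - z‖ ^ (n - 4))⁻¹ := fun x z =>
    mul_nonneg (Real.rpow_nonneg (hv0 z) _) (by positivity)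
  have hc' : ENNReal.ofReal c ≠ 0 := by simpa using hc
  have hfin : ∀ x : E, ∫⁻ z, ENNReal.ofReal (v z ^ p * (‖x - z‖ ^ (n - 4))⁻¹) < ⊤ := by
    intro x
    refine lt_top_iff_ne_top.2 fun htop => ?_
    have := h x
    rw [htop, ENNReal.mul_top hc'] at this
    exact ENNReal.ofReal_ne_top this
  refine ⟨hvc, fun x => ?_, hvM, fun x => ?_, fun x => ?_⟩
  · refine lt_of_le_of_ne (hv0 x) fun hx => ?_
    have hx' := h x
    rw [← hx, ENNReal.ofReal_zero, eq_comm, mul_eq_zero, or_iff_right hc',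
      lintegral_eq_zero_iff (hmeas x).ennreal_ofReal] at hx'
    have hopen : IsOpen ({z | 0 < v z} : Set E) := isOpen_lt continuous_const hvc
    have hpos : 0 < volume (({z | 0 < v z} : Set E) \ {x}) := by
      rw [measure_sdiff_null (by simp)]
      exact hopen.measure_pos _ ⟨0, by simp [hv1]⟩
    refine hpos.ne' (measure_mono_null ?_ (ae_iff.1 hx'))
    rintro z ⟨hz, hzx⟩
    have h1 : 0 < ‖x - z‖ := norm_pos_iff.2 (sub_ne_zero.2 fun e => hzx e.symm)
    have h2 : 0 < v z ^ p := Real.rpow_pos_of_pos hz _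
    have h3 : 0 < v z ^ p * (‖x - z‖ ^ (n - 4))⁻¹ := by positivity
    simpa using h3
  · exact ⟨(hmeas x).aestronglyMeasurable,
      (hasFiniteIntegral_iff_ofReal (Eventually.of_forall (hnn x))).2 (hfin x)⟩
  · rw [integral_eq_lintegral_of_nonneg_ae (Eventually.of_forall (hnn x))
      (hmeas x).aestronglyMeasurable, ← ENNReal.toReal_ofReal (hv0 x), h x, ENNReal.toReal_mul,
      ENNReal.toReal_ofReal hc.le]

/-- Bounded solutions normalised at the centre do not exist on large balls. -/
lemma exists_radius_no_solution (hn : 5 ≤ n) {p : ℝ} (hp : 1 < p)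
    (hp2 : p < ((n : ℝ) + 4) / ((n : ℝ) - 4)) (M : ℝ) :
    ∃ K : ℕ, ∀ W : E → ℝ, ContDiff ℝ 4 W → (∀ y ∈ ball (0 : E) K, 0 ≤ W y) →
      (∀ y ∈ ball (0 : E) K, W y ≤ M) → (∀ y ∈ ball (0 : E) K, bilap W y = W y ^ p) →
      W 0 ≠ 1 := by
  by_contra hcon
  push Not at hcon
  choose W hW hW0 hWM hWp hW1 using hcon
  obtain ⟨v, C, hvc, hv0, hvM, hv1, hv⟩ := exists_limit hn hp hW hW0 hWM hWp hW1
  obtain ⟨c, hc, heq⟩ := exists_integral_equation hn hp hvc hv0 hv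
  exact not_isIntegralSol hn hp hp2 hc
    (isIntegralSol_of_lintegral hn (by linarith) hc hvc hv0 hvM hv1 heq)

/-- Universal bound for solutions in a ball. -/
lemma exists_mul_rpow_le (hn : 5 ≤ n) {p : ℝ} (hp : 1 < p)
    (hp2 : p < ((n : ℝ) + 4) / ((n : ℝ) - 4)) :
    ∃ C : ℝ, 0 ≤ C ∧ ∀ (u : E → ℝ) (x : E) (r : ℝ), ContDiff ℝ 4 u → 0 < r →
      (∀ y ∈ ball x r, 0 ≤ u y) → (∀ y ∈ ball x r, bilap u y = u y ^ p) →
      r ^ (4 / (p - 1)) * u x ≤ C := by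
  set σ := 4 / (p - 1) with hσdef
  have hp1 : 0 < p - 1 := by linarith
  have hσ : 0 < σ := by positivity
  obtain ⟨K, hK⟩ := exists_radius_no_solution (n := n) hn hp hp2 (2 ^ σ)
  refine ⟨(2 * K) ^ σ, by positivity, fun u x r hu hr hu0 hup => ?_⟩
  by_contra! hlt
  set φ : E → ℝ := fun y => (r - ‖y - x‖) ^ σ * u y with hφ
  have hφc : Continuous φ := by
    have h1 : Continuous fun y : E => (r - ‖y - x‖) ^ σ :=
      (by fun_prop : Continuous fun y : E => r - ‖y - x‖).rpow_const fun _ => Or.inr hσ.le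
    exact h1.mul hu.continuous
  obtain ⟨w, hw, hmax⟩ := (isCompact_closedBall x r).exists_isMaxOn
    ⟨x, mem_closedBall_self hr.le⟩ hφc.continuousOn
  have hφx : φ x = r ^ σ * u x := by simp [hφ]
  have hφw : (2 * K) ^ σ < φ w := by
    rw [← hφx] at hlt
    exact hlt.trans_le (hmax (mem_closedBall_self hr.le))
  have hφw0 : 0 < φ w := lt_of_le_of_lt (by positivity) hφw
  set d := r - ‖w - x‖ with hd
  rw [mem_closedBall, dist_eq_norm] at hw
  have hd0 : 0 < d := by
    rcases (sub_nonneg.2 hw).lt_or_eq with h | h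
    · exact h
    · simp only [hφ] at hφw0
      rw [← h, Real.zero_rpow hσ.ne', zero_mul] at hφw0
      exact absurd hφw0 (lt_irrefl _)
  have huw : 0 < u w := by
    have : 0 < d ^ σ := Real.rpow_pos_of_pos hd0 _
    exact pos_of_mul_pos_right hφw0 this.le
  set lam := u w ^ (-(1 / σ)) with hlam
  have hlam0 : 0 < lam := Real.rpow_pos_of_pos huw _
  have hlamσ : lam ^ σ = (u w)⁻¹ := by
    rw [hlam, ← Real.rpow_mul huw.le, neg_mul, one_div_mul_cancel hσ.ne', Real.rpow_neg_one]
  have hlam4 : lam ^ 4 = u w ^ (-(p - 1)) := by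
    rw [hlam, ← Real.rpow_natCast, ← Real.rpow_mul huw.le]
    congr 1
    rw [hσdef]
    push_cast
    field_simp
  have hKd : 2 * K * lam < d := by
    have h1 : (2 * K * lam) ^ σ < d ^ σ := by
      rw [Real.mul_rpow (by positivity) hlam0.le, hlamσ, ← div_eq_mul_inv, div_lt_iff₀ huw]
      exact hφw
    exact (Real.rpow_lt_rpow_iff (by positivity) hd0.le hσ).1 h1
  have hmem : ∀ z ∈ ball (0 : E) K, ‖w + lam • z - x‖ < r - d / 2 := by
    intro z hz
    rw [mem_ball_zero_iff] at hz
    have h1 : ‖w + lam • z - x‖ ≤ ‖w - x‖ + lam * ‖z‖ := by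
      have : w + lam • z - x = (w - x) + lam • z := by abel
      rw [this]
      refine (norm_add_le _ _).trans_eq ?_
      rw [norm_smul, Real.norm_of_nonneg hlam0.le]
    have h2 : lam * ‖z‖ < lam * K := by gcongr
    linarith
  have hball : ∀ z ∈ ball (0 : E) K, w + lam • z ∈ ball x r := fun z hz => by
    rw [mem_ball, dist_eq_norm]
    linarith [hmem z hz]
  refine hK (fun z => (u w)⁻¹ * u (w + lam • z)) ?_ ?_ ?_ ?_ ?_
  · fun_prop
  · exact fun z hz => mul_nonneg (inv_nonneg.2 huw.le) (hu0 _ (hball z hz))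
  · intro z hz
    have h1 := hmem z hz
    have h2 : φ (w + lam • z) ≤ φ w := hmax (ball_subset_closedBall (hball z hz))
    have h3 : (d / 2) ^ σ * u (w + lam • z) ≤ φ (w + lam • z) := by
      have := hu0 _ (hball z hz)
      simp only [hφ]
      gcongr
      linarith
    have h4 : (d / 2) ^ σ * u (w + lam • z) ≤ d ^ σ * u w := h3.trans h2
    rw [Real.div_rpow hd0.le zero_le_two, div_mul_eq_mul_div,
      div_le_iff₀ (by positivity), mul_assoc, mul_le_mul_iff_right₀ (by positivity)] at h4
    rw [inv_mul_le_iff₀ huw]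
    exact h4
  · intro z hz
    rw [bilap_comp hu]
    simp only
    rw [hup _ (hball z hz), hlam4, Real.mul_rpow (inv_nonneg.2 huw.le) (hu0 _ (hball z hz)),
      Real.inv_rpow huw.le, ← Real.rpow_neg huw.le, ← Real.rpow_neg_one, ← Real.rpow_add huw]
    congr 2
    ring
  · simp [huw.ne']

lemma exists_contDiff_extension {u : E → ℝ} {x : E} {s r : ℝ} (hs : 0 < s) (hsr : s < r)
    (hu : ContDiffOn ℝ 4 u (ball x r)) :
    ∃ U : E → ℝ, ContDiff ℝ 4 U ∧ ∀ y ∈ ball x s, U y = u y := by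
  let f : ContDiffBump x := ⟨s, (s + r) / 2, hs, by linarith⟩
  refine ⟨fun y => f y * u y, contDiff_iff_contDiffAt.2 fun y => ?_, fun y hy => ?_⟩
  · by_cases hy : y ∈ ball x r
    · exact f.contDiff.contDiffAt.mul (hu.contDiffAt (isOpen_ball.mem_nhds hy))
    · have hy' : (s + r) / 2 < dist y x := by
        rw [mem_ball, not_lt] at hy
        linarith
      have h0 : (fun y => f y * u y) =ᶠ[𝓝 y] fun _ => 0 := by
        have hc : Continuous fun z : E => dist z x := by fun_prop
        filter_upwards [hc.continuousAt.eventually_const_lt hy'] with z hz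
        rw [f.zero_of_le_dist hz.le, zero_mul]
      exact contDiffAt_const.congr_of_eventuallyEq h0
  · simp only
    rw [f.one_of_mem_closedBall (ball_subset_closedBall hy), one_mul]

end Assembly

section Rescaling

lemma norm_iteratedFDeriv_mul_comp_add_smul {n : ℕ} {U : EuclideanSpace ℝ (Fin n) → ℝ}
    (hU : ContDiff ℝ 4 U) {c t : ℝ} (hc : 0 ≤ c) (ht : 0 ≤ t) (x : EuclideanSpace ℝ (Fin n))
    {j : ℕ} (hj : j ≤ 3) :
    ‖iteratedFDeriv ℝ j (fun z => c * U (x + t • z)) 0‖ =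
      c * t ^ j * ‖iteratedFDeriv ℝ j U x‖ := by
  have hUj : ContDiff ℝ j U := hU.of_le (by exact_mod_cast (by omega : j ≤ 4))
  have h1 : ContDiff ℝ j fun z => U (x + z) := by fun_prop
  have h2 := congrFun (iteratedFDeriv_comp_const_smul t h1) 0
  have h3 : ContDiff ℝ j fun z => U (x + t • z) := by fun_prop
  have h4 := iteratedFDeriv_const_smul_apply' (a := c) (h3.contDiffAt (x := 0))
  simp only [smul_eq_mul] at h4
  rw [h4, h2, iteratedFDeriv_comp_add_left, smul_zero, add_zero, norm_smul, norm_smul,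
    Real.norm_of_nonneg hc, Real.norm_of_nonneg (pow_nonneg ht j), mul_assoc]

lemma exists_rpow_mul_norm_iteratedFDeriv_le {n : ℕ} (hn : 5 ≤ n) {p : ℝ} (hp : 1 < p)
    (hp2 : p < ((n : ℝ) + 4) / ((n : ℝ) - 4)) :
    ∃ C : ℝ, ∀ u : EuclideanSpace ℝ (Fin n) → ℝ, ∀ (x : EuclideanSpace ℝ (Fin n)) (r : ℝ), 0 < r →
      ContDiffOn ℝ 4 u (ball x r) → (∀ y ∈ ball x r, 0 ≤ u y) →
      (∀ y ∈ ball x r, bilap u y = u y ^ p) →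
      ∀ k : ℕ, k ≤ 3 → r ^ (4 / (p - 1) + (k : ℝ)) * ‖iteratedFDeriv ℝ k u x‖ ≤ C := by
  have hp1 : 0 < p - 1 := by linarith
  set σ := 4 / (p - 1) with hσdef
  have hσ : 0 < σ := by positivity
  have hσp : σ * p = σ + 4 := by
    rw [hσdef]; field_simp; ring
  obtain ⟨C₀, hC₀, hder⟩ := exists_norm_iteratedFDeriv_le hn
  obtain ⟨C, hC, hbound⟩ := exists_mul_rpow_le hn hp hp2
  set A := 2 ^ σ * C with hA
  have hA0 : 0 ≤ A := by positivity
  refine ⟨64 * (C₀ * max A (A ^ p)), fun u x r hr hu hu0 hup k hk => ?_⟩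
  obtain ⟨U, hU, hUu⟩ := exists_contDiff_extension (x := x) (s := 3 * r / 4) (r := r)
    (by linarith) (by linarith) hu
  have hUev : ∀ y ∈ ball x (3 * r / 4), U =ᶠ[𝓝 y] u := fun y hy =>
    eventually_of_mem (isOpen_ball.mem_nhds hy) hUu
  have hsub : ball x (3 * r / 4) ⊆ ball x r := ball_subset_ball (by linarith)
  have hU0 : ∀ y ∈ ball x (3 * r / 4), 0 ≤ U y := fun y hy => by
    rw [hUu y hy]; exact hu0 y (hsub hy)
  have hUp : ∀ y ∈ ball x (3 * r / 4), bilap U y = U y ^ p := fun y hy => by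
    rw [bilap_congr (hUev y hy), hUu y hy]; exact hup y (hsub hy)
  have hr4 : 0 ≤ r / 4 := by positivity
  have hrσ : 0 < r ^ σ := Real.rpow_pos_of_pos hr _
  have hmem : ∀ z ∈ closedBall (0 : EuclideanSpace ℝ (Fin n)) 1,
      dist (x + (r / 4) • z) x ≤ r / 4 := by
    intro z hz
    rw [mem_closedBall_zero_iff] at hz
    rw [dist_eq_norm, add_sub_cancel_left, norm_smul, Real.norm_of_nonneg hr4]
    nlinarith
  have hlow : ∀ z ∈ closedBall (0 : EuclideanSpace ℝ (Fin n)) 1,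
      0 ≤ U (x + (r / 4) • z) := fun z hz => hU0 _ (by
    rw [mem_ball]; linarith [hmem z hz])
  have hupp : ∀ z ∈ closedBall (0 : EuclideanSpace ℝ (Fin n)) 1,
      r ^ σ * U (x + (r / 4) • z) ≤ A := by
    intro z hz
    have hs : ball (x + (r / 4) • z) (r / 2) ⊆ ball x (3 * r / 4) :=
      ball_subset_ball' (by linarith [hmem z hz])
    have h := hbound U (x + (r / 4) • z) (r / 2) hU (by linarith) (fun y hy => hU0 y (hs hy))
      (fun y hy => hUp y (hs hy))
    rw [Real.div_rpow hr.le zero_le_two, div_mul_eq_mul_div, div_le_iff₀ (by positivity)] at h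
    linarith
  have h := hder (fun z => r ^ σ * U (x + (r / 4) • z)) (max A (A ^ p)) (by fun_prop)
    (fun z hz => by
      rw [abs_of_nonneg (mul_nonneg hrσ.le (hlow z hz))]
      exact (hupp z hz).trans (le_max_left _ _))
    (fun z hz => by
      rw [bilap_comp hU]
      simp only
      rw [hUp _ (by rw [mem_ball]; linarith [hmem z hz])]
      have h1 : r ^ σ * (r / 4) ^ 4 * U (x + (r / 4) • z) ^ p =
          (1 / 256) * (r ^ σ * U (x + (r / 4) • z)) ^ p := by
        rw [Real.mul_rpow hrσ.le (hlow z hz), ← Real.rpow_mul hr.le, hσp, Real.rpow_add hr]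
        norm_cast
        ring
      have h2 : 0 ≤ (r ^ σ * U (x + (r / 4) • z)) ^ p :=
        Real.rpow_nonneg (mul_nonneg hrσ.le (hlow z hz)) _
      have h3 := Real.rpow_le_rpow (mul_nonneg hrσ.le (hlow z hz)) (hupp z hz)
        (by linarith : 0 ≤ p)
      rw [h1, abs_of_nonneg (by positivity)]
      refine le_trans ?_ (le_max_right _ _)
      linarith) k hk
  rw [norm_iteratedFDeriv_mul_comp_add_smul hU hrσ.le hr4 x hk,
    ((hUev x (mem_ball_self (by linarith))).iteratedFDeriv ℝ k).eq_of_nhds] at h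
  rw [Real.rpow_add hr, Real.rpow_natCast]
  have h4 : (4 : ℝ) ^ k ≤ 4 ^ 3 := pow_le_pow_right₀ (by norm_num) hk
  have h5 : 0 ≤ C₀ * max A (A ^ p) := mul_nonneg hC₀ (hA0.trans (le_max_left _ _))
  calc r ^ σ * r ^ k * ‖iteratedFDeriv ℝ k u x‖
      = 4 ^ k * (r ^ σ * (r / 4) ^ k * ‖iteratedFDeriv ℝ k u x‖) := by
        rw [div_pow]; field_simp
    _ ≤ 4 ^ k * (C₀ * max A (A ^ p)) := by gcongr
    _ ≤ 64 * (C₀ * max A (A ^ p)) := by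
        refine mul_le_mul_of_nonneg_right ?_ h5
        linarith

end Rescaling

end GradientEstimates

/-- Gradient estimates near the singularity: there is `C₁ = C₁(n,p)` such that
for every nonnegative `C⁴` solution of `Δ²u = u^p` in the punctured unit ball,
`∑_{k ≤ 3} |x|^{4/(p-1)+k} |∇ᵏu(x)| ≤ C₁` for `0 < |x| ≤ 1/4`. -/
theorem stmt_4 (n : ℕ) (hn : 5 ≤ n) (p : ℝ)
    (hp1 : 1 < p) (hp2 : p < ((n : ℝ) + 4) / ((n : ℝ) - 4)) :
    ∃ C₁ : ℝ, ∀ u : EuclideanSpace ℝ (Fin n) → ℝ,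
      ContDiffOn ℝ 4 u (ball 0 1 \ {0}) →
      (∀ x ∈ ball (0 : EuclideanSpace ℝ (Fin n)) 1 \ {0}, 0 ≤ u x) →
      (∀ x ∈ ball (0 : EuclideanSpace ℝ (Fin n)) 1 \ {0}, bilap u x = u x ^ p) →
      ∀ x : EuclideanSpace ℝ (Fin n), x ≠ 0 → ‖x‖ ≤ 1 / 4 →
        ∑ k ∈ Finset.range 4,
          ‖x‖ ^ ((4 : ℝ) / (p - 1) + (k : ℝ)) * ‖iteratedFDeriv ℝ k u x‖ ≤ C₁ := by
  obtain ⟨C, hC⟩ := exists_rpow_mul_norm_iteratedFDeriv_le hn hp1 hp2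
  refine ⟨4 * C, fun u hu hu0 hup x hx hx4 => ?_⟩
  have hx' := norm_pos_iff.2 hx
  have hsub : ball x ‖x‖ ⊆ ball 0 1 \ {0} := by
    intro y hy
    rw [mem_ball, dist_eq_norm] at hy
    refine ⟨?_, fun hy0 => ?_⟩
    · rw [mem_ball_zero_iff]
      have := norm_le_norm_add_norm_sub' y x
      linarith
    · rw [Set.mem_singleton_iff] at hy0
      rw [hy0, zero_sub, norm_neg] at hy
      exact lt_irrefl _ hy
  have h := Finset.sum_le_card_nsmul (Finset.range 4)
    (fun k => ‖x‖ ^ ((4 : ℝ) / (p - 1) + (k : ℝ)) * ‖iteratedFDeriv ℝ k u x‖) C fun k hk =>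
      hC u x ‖x‖ hx' (hu.mono hsub) (fun y hy => hu0 y (hsub hy)) (fun y hy => hup y (hsub hy)) k
        (by have := Finset.mem_range.1 hk; omega)
  refine h.trans_eq ?_
  simp
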